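/- arXiv:2210.12912 — 7 statements merged into one kernel-verified Lean document; each statement's English description precedes it below -/
import Mathlib

section
/- Let β > 0, σ > 0 and κ > κ_c := βσ² + σ⁴/2. Then the map F_κ has a strictly positive fixed point: there exists γ* with 0 < γ* ≤ κ such that F_κ(γ*) = γ*. Consequently the probability measure μ^{γ*} satisfies ∫ cos(x) μ^{γ*}(dx) = γ*/κ > 0, so μ^{γ*} is not the uniform measure on [−π, π). -/
open Real MeasureTheory Filter Topology

theorem deriv_deriv_nonpos_of_isLocalMax {h : ℝ → ℝ} {x : ℝ} (hc : ContinuousAt h x)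
    (hx : IsLocalMax h x) : deriv (deriv h) x ≤ 0 := by
  by_contra! hpos
  have hmin := isLocalMin_of_deriv_deriv_pos hpos hx.deriv_eq_zero hc
  have hconst : h =ᶠ[𝓝 x] fun _ => h x := by
    filter_upwards [hx, hmin] with y h1 h2 using le_antisymm h1 h2
  have h0 : deriv (deriv h) x = 0 := by
    rw [hconst.deriv.deriv_eq]
    simp
  linarith

theorem exists_forall_le_of_continuous_periodic {h : ℝ → ℝ} {T : ℝ} (hT : 0 < T)
    (hc : Continuous h) (hp : Function.Periodic h T) : ∃ x, ∀ y, h y ≤ h x := by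
  obtain ⟨x, -, hx⟩ := isCompact_Icc.exists_isMaxOn (Set.nonempty_Icc.2 hT.le) hc.continuousOn
  refine ⟨x, fun y => ?_⟩
  obtain ⟨z, hz, hyz⟩ := hp.exists_mem_Ico₀ hT y
  rw [hyz]
  exact hx (Set.Ico_subset_Icc_self hz)

/-- Comparison principle for the periodic operator `f ↦ β f - s f'' + (f')² / 2`. -/
theorem sub_le_div_of_periodic_comparison {β s C T : ℝ} (hβ : 0 < β) (hs : 0 ≤ s) (hT : 0 < T)
    {f g : ℝ → ℝ} (hf : ContDiff ℝ 2 f) (hg : ContDiff ℝ 2 g)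
    (hfp : Function.Periodic f T) (hgp : Function.Periodic g T)
    (hfg : ∀ x, (β * f x - s * deriv (deriv f) x + (1 / 2) * (deriv f x) ^ 2)
      - (β * g x - s * deriv (deriv g) x + (1 / 2) * (deriv g x) ^ 2) ≤ C) (x : ℝ) :
    f x - g x ≤ C / β := by
  obtain ⟨m, hm⟩ := exists_forall_le_of_continuous_periodic hT
    (hf.continuous.sub hg.continuous) (hfp.sub hgp)
  have hmax : IsLocalMax (f - g) m := Eventually.of_forall hm
  have hfd : Differentiable ℝ f := hf.differentiable (by norm_num)
  have hgd : Differentiable ℝ g := hg.differentiable (by norm_num)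
  have hf' : Differentiable ℝ (deriv f) :=
    hf.differentiable_deriv_two
  have hg' : Differentiable ℝ (deriv g) :=
    hg.differentiable_deriv_two
  have hd : deriv (f - g) = deriv f - deriv g := by
    ext y
    exact deriv_sub (hfd y) (hgd y)
  have h1 : deriv f m = deriv g m := by
    have := hmax.deriv_eq_zero
    rw [hd] at this
    exact sub_eq_zero.1 this
  have h2 : deriv (deriv f) m - deriv (deriv g) m ≤ 0 := by
    have := deriv_deriv_nonpos_of_isLocalMax
      (hf.continuous.sub hg.continuous).continuousAt hmax
    rwa [hd, deriv_sub (hf' m) (hg' m)] at this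
  have h3 := hfg m
  rw [h1] at h3
  have h4 : f x - g x ≤ f m - g m := hm x
  rw [le_div_iff₀ hβ]
  nlinarith [mul_le_mul_of_nonneg_left h4 hβ.le, mul_nonneg hs (neg_nonneg.2 h2)]

theorem abs_exp_sub_one_sub_le {y p δ : ℝ} (hy : |y| ≤ 1) (hyp : |y - p| ≤ δ) :
    |exp y - (1 + p)| ≤ y ^ 2 + δ := by
  have h := abs_exp_sub_one_sub_id_le hy
  calc |exp y - (1 + p)| = |(exp y - 1 - y) + (y - p)| := by ring_nf
    _ ≤ _ := (abs_add_le _ _).trans (add_le_add h hyp)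

/-- If a continuous weight is close to `1 + b cos`, its cosine moment and its mass are close to
those of `1 + b cos`. -/
theorem integral_cos_mul_bounds {w : ℝ → ℝ} {b ε : ℝ} (hw : Continuous w)
    (h : ∀ x, |w x - (1 + b * cos x)| ≤ ε) :
    π * b - 2 * π * ε ≤ ∫ x in (-π)..π, cos x * w x ∧
      ∫ x in (-π)..π, w x ≤ 2 * π * (1 + ε) := by
  have hπ : -π ≤ π := by linarith [pi_pos]
  constructor
  · have e : ∫ x in (-π)..π, (cos x + b * cos x ^ 2 - ε) = π * b - 2 * π * ε := by
      rw [intervalIntegral.integral_sub, intervalIntegral.integral_add,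
        intervalIntegral.integral_const_mul, integral_cos_sq]
      · simp
        ring
      all_goals exact Continuous.intervalIntegrable (by fun_prop) _ _
    rw [← e]
    refine intervalIntegral.integral_mono_on hπ
      (Continuous.intervalIntegrable (by fun_prop) _ _)
      (Continuous.intervalIntegrable (by fun_prop) _ _) fun x _ => ?_
    have h1 : |cos x * (w x - (1 + b * cos x))| ≤ ε := by
      rw [abs_mul]
      nlinarith [h x, abs_cos_le_one x, abs_nonneg (w x - (1 + b * cos x))]
    nlinarith [(abs_le.1 h1).1]
  · have e : ∫ x in (-π)..π, (1 + b * cos x + ε) = 2 * π * (1 + ε) := by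
      rw [intervalIntegral.integral_add, intervalIntegral.integral_add,
        intervalIntegral.integral_const_mul]
      · simp
        ring
      all_goals exact Continuous.intervalIntegrable (by fun_prop) _ _
    rw [← e]
    refine intervalIntegral.integral_mono_on hπ
      (Continuous.intervalIntegrable (by fun_prop) _ _)
      (Continuous.intervalIntegrable (by fun_prop) _ _) fun x _ => ?_
    linarith [(abs_le.1 (h x)).2]

section PeriodicSolutions

variable {β s γ γ' : ℝ} {v v' : ℝ → ℝ}

theorem abs_sub_le_of_periodic_solutions (hβ : 0 < β) (hs : 0 ≤ s)
    (hv : ContDiff ℝ 2 v) (hv' : ContDiff ℝ 2 v')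
    (hp : Function.Periodic v (2 * π)) (hp' : Function.Periodic v' (2 * π))
    (h : ∀ x, β * v x - s * deriv (deriv v) x + (1 / 2) * (deriv v x) ^ 2 = -γ * cos x)
    (h' : ∀ x, β * v' x - s * deriv (deriv v') x + (1 / 2) * (deriv v' x) ^ 2 = -γ' * cos x)
    (x : ℝ) : |v x - v' x| ≤ |γ - γ'| / β := by
  have key (y : ℝ) : |(γ - γ') * cos y| ≤ |γ - γ'| := by
    rw [abs_mul]
    exact mul_le_of_le_one_right (abs_nonneg _) (abs_cos_le_one y)
  rw [abs_sub_le_iff]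
  constructor
  · refine sub_le_div_of_periodic_comparison hβ hs two_pi_pos hv hv' hp hp' (fun y => ?_) x
    rw [h, h']
    linarith [(abs_le.1 (key y)).1]
  · refine sub_le_div_of_periodic_comparison hβ hs two_pi_pos hv' hv hp' hp (fun y => ?_) x
    rw [h, h']
    linarith [(abs_le.1 (key y)).2]

theorem abs_le_of_periodic_solution (hβ : 0 < β) (hs : 0 ≤ s) (hv : ContDiff ℝ 2 v)
    (hp : Function.Periodic v (2 * π))
    (h : ∀ x, β * v x - s * deriv (deriv v) x + (1 / 2) * (deriv v x) ^ 2 = -γ * cos x)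
    (x : ℝ) : |v x| ≤ |γ| / β := by
  simpa using abs_sub_le_of_periodic_solutions (γ' := 0) (v' := fun _ => 0) hβ hs hv
    contDiff_const hp (fun _ => rfl) h (by simp) x

theorem abs_add_cos_le_of_periodic_solution (hβ : 0 < β) (hs : 0 ≤ s) (hv : ContDiff ℝ 2 v)
    (hp : Function.Periodic v (2 * π))
    (h : ∀ x, β * v x - s * deriv (deriv v) x + (1 / 2) * (deriv v x) ^ 2 = -γ * cos x)
    (x : ℝ) : |v x - -(γ / (β + s)) * cos x| ≤ (γ / (β + s)) ^ 2 / 2 / β := by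
  have hA : 0 < β + s := by linarith
  set a := γ / (β + s) with ha
  have haγ : a * (β + s) = γ := div_mul_cancel₀ _ hA.ne'
  have hw : ContDiff ℝ 2 fun x => -a * cos x := contDiff_const.mul contDiff_cos
  have hwp : Function.Periodic (fun x => -a * cos x) (2 * π) := fun y => by simp
  have hd1 : deriv (fun x => -a * cos x) = fun x => a * sin x := by
    ext y
    simp
  have hd2 (y : ℝ) : deriv (deriv fun x => -a * cos x) y = a * cos y := by
    rw [hd1]
    simp
  have hS (y : ℝ) : a ^ 2 * sin y ^ 2 ≤ a ^ 2 :=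
    mul_le_of_le_one_right (sq_nonneg _) (sin_sq_le_one y)
  rw [abs_sub_le_iff]
  constructor
  · refine sub_le_div_of_periodic_comparison hβ hs two_pi_pos hv hw hp hwp (fun y => ?_) x
    rw [h, hd2, hd1, ← haγ]
    nlinarith [sq_nonneg a, sq_nonneg (a * sin y)]
  · refine sub_le_div_of_periodic_comparison hβ hs two_pi_pos hw hv hwp hp (fun y => ?_) x
    rw [h, hd2, hd1, ← haγ]
    nlinarith [hS y]

/-- The Gibbs weight of a periodic solution agrees with `1 + γ / (s (β + s)) cos` up to `O(γ²)`. -/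
theorem abs_exp_neg_sub_le_of_periodic_solution (hβ : 0 < β) (hs : 0 < s) (hv : ContDiff ℝ 2 v)
    (hp : Function.Periodic v (2 * π))
    (h : ∀ x, β * v x - s * deriv (deriv v) x + (1 / 2) * (deriv v x) ^ 2 = -γ * cos x)
    (hγ : |γ| ≤ β * s) (x : ℝ) :
    |exp (-(1 / s) * v x) - (1 + γ / (s * (β + s)) * cos x)| ≤
      (1 / (β * s) ^ 2 + 1 / (2 * (β + s) ^ 2 * β * s)) * γ ^ 2 := by
  have hA : 0 < β + s := by linarith
  have h1 : |-(1 / s) * v x| ≤ |γ| / (β * s) := by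
    rw [abs_mul, abs_neg, abs_of_pos (one_div_pos.2 hs)]
    calc 1 / s * |v x| ≤ 1 / s * (|γ| / β) := by
          gcongr
          exact abs_le_of_periodic_solution hβ hs.le hv hp h x
      _ = _ := by field_simp
  have h2 : |-(1 / s) * v x - γ / (s * (β + s)) * cos x| ≤ γ ^ 2 / (2 * (β + s) ^ 2 * β * s) := by
    have e : -(1 / s) * v x - γ / (s * (β + s)) * cos x
        = -(1 / s) * (v x - -(γ / (β + s)) * cos x) := by
      field_simp
      ring
    rw [e, abs_mul, abs_neg, abs_of_pos (one_div_pos.2 hs)]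
    calc _ ≤ 1 / s * ((γ / (β + s)) ^ 2 / 2 / β) := by
          gcongr
          exact abs_add_cos_le_of_periodic_solution hβ hs.le hv hp h x
      _ = _ := by field_simp
  have h3 : |-(1 / s) * v x| ≤ 1 := h1.trans ((div_le_one (by positivity)).2 hγ)
  refine (abs_exp_sub_one_sub_le h3 h2).trans ?_
  have h4 : (-(1 / s) * v x) ^ 2 ≤ (|γ| / (β * s)) ^ 2 := by
    rw [← sq_abs]
    gcongr
  rw [div_pow, sq_abs] at h4
  calc _ ≤ γ ^ 2 / (β * s) ^ 2 + γ ^ 2 / (2 * (β + s) ^ 2 * β * s) := by gcongr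
    _ = _ := by ring

end PeriodicSolutions

theorem continuous_uncurry_of_periodic_solutions {β s : ℝ} (hβ : 0 < β) (hs : 0 ≤ s)
    {v : ℝ → ℝ → ℝ} (hper : ∀ γ, 0 ≤ γ → Function.Periodic (v γ) (2 * π))
    (hC2 : ∀ γ, 0 ≤ γ → ContDiff ℝ 2 (v γ))
    (hODE : ∀ γ, 0 ≤ γ → ∀ x,
      β * v γ x - s * deriv (deriv (v γ)) x + (1 / 2) * (deriv (v γ) x) ^ 2 = -γ * cos x) :
    Continuous fun p : ℝ × ℝ => v (max p.1 0) p.2 := by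
  have hpos (γ : ℝ) : 0 ≤ max γ 0 := le_max_right _ _
  refine continuous_prod_of_continuous_lipschitzWith _ (1 / β).toNNReal
    (fun γ => (hC2 _ (hpos γ)).continuous) fun x => LipschitzWith.of_dist_le_mul fun γ γ' => ?_
  rw [Real.coe_toNNReal _ (by positivity), Real.dist_eq, Real.dist_eq]
  refine (abs_sub_le_of_periodic_solutions hβ hs (hC2 _ (hpos γ)) (hC2 _ (hpos γ'))
    (hper _ (hpos γ)) (hper _ (hpos γ')) (hODE _ (hpos γ)) (hODE _ (hpos γ')) x).trans ?_
  rw [div_eq_inv_mul, one_div]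
  exact mul_le_mul_of_nonneg_left (abs_max_sub_max_le_abs γ γ' 0) (inv_nonneg.2 hβ.le)

theorem integral_cos_mul_le {w : ℝ → ℝ} (hw : Continuous w) (h0 : ∀ x, 0 ≤ w x) :
    ∫ x in (-π)..π, cos x * w x ≤ ∫ x in (-π)..π, w x := by
  refine intervalIntegral.integral_mono_on (by linarith [pi_pos])
    (Continuous.intervalIntegrable (by fun_prop) _ _) (hw.intervalIntegrable _ _) fun x _ => ?_
  exact mul_le_of_le_one_left (h0 x) (cos_le_one x)

/-- For `κ > κ_c := βσ² + σ⁴/2`, the map `F_κ` has a strictly positive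
fixed point `γ* ≤ κ`, and consequently `μ^{γ*}(cos) = γ*/κ > 0`, so `μ^{γ*}` is not
the uniform measure. -/
theorem kuramoto_supercritical_fixed_point
    (β σ : ℝ) (hβ : 0 < β) (hσ : 0 < σ)
    (v : ℝ → ℝ → ℝ)
    (hper : ∀ γ, 0 ≤ γ → Function.Periodic (v γ) (2 * π))
    (hC2 : ∀ γ, 0 ≤ γ → ContDiff ℝ 2 (v γ))
    (hODE : ∀ γ, 0 ≤ γ → ∀ x : ℝ,
      β * v γ x - σ ^ 2 / 2 * deriv (deriv (v γ)) x + (1 / 2) * (deriv (v γ) x) ^ 2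
        = -γ * Real.cos x)
    (Z : ℝ → ℝ)
    (hZ : ∀ γ, Z γ = ∫ y in (-π)..π, Real.exp (-(2 / σ ^ 2) * v γ y))
    (F : ℝ → ℝ → ℝ)
    (hF : ∀ κ γ, F κ γ
      = κ * (∫ x in (-π)..π, Real.cos x * Real.exp (-(2 / σ ^ 2) * v γ x)) / Z γ)
    (κ : ℝ) (hκ : β * σ ^ 2 + σ ^ 4 / 2 < κ) :
    ∃ γs : ℝ, 0 < γs ∧ γs ≤ κ ∧ F κ γs = γs ∧
      (∫ x in (-π)..π, Real.cos x * Real.exp (-(2 / σ ^ 2) * v γs x)) / Z γs = γs / κ ∧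
      0 < γs / κ := by
  obtain ⟨s, hs⟩ : ∃ s, s = σ ^ 2 / 2 := ⟨_, rfl⟩
  have hspos : 0 < s := by rw [hs]; positivity
  have hc : 2 / σ ^ 2 = 1 / s := by rw [hs]; field_simp
  have hκ' : 2 * s * (β + s) < κ := by
    convert hκ using 1
    rw [hs]
    ring
  rw [← hs] at hODE
  simp_rw [hc] at hZ hF ⊢
  have hκ0 : 0 < κ := lt_trans (by positivity) hκ'
  set N : ℝ → ℝ := fun γ => ∫ x in (-π)..π, cos x * exp (-(1 / s) * v γ x)
  have hcont := continuous_uncurry_of_periodic_solutions hβ hspos.le hper hC2 hODE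
  have hw (γ : ℝ) (hγ : 0 ≤ γ) : Continuous fun x => exp (-(1 / s) * v γ x) := by
    have := (hC2 γ hγ).continuous
    fun_prop
  have hZpos (γ : ℝ) (hγ : 0 ≤ γ) : 0 < Z γ := by
    rw [hZ]
    exact intervalIntegral.intervalIntegral_pos_of_pos ((hw γ hγ).intervalIntegrable _ _)
      (fun x => exp_pos _) (by linarith [pi_pos])
  have hNcont : Continuous fun γ => N (max γ 0) :=
    intervalIntegral.continuous_parametric_intervalIntegral_of_continuous'
      (f := fun γ x => cos x * exp (-(1 / s) * v (max γ 0) x))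
      ((continuous_cos.comp continuous_snd).mul (continuous_exp.comp (hcont.const_mul _))) _ _
  have hZcont : Continuous fun γ => Z (max γ 0) := by
    simp_rw [hZ]
    exact intervalIntegral.continuous_parametric_intervalIntegral_of_continuous'
      (f := fun γ x => exp (-(1 / s) * v (max γ 0) x))
      (continuous_exp.comp (hcont.const_mul _)) _ _
  obtain ⟨M, hM⟩ : ∃ M, M = 1 / (β * s) ^ 2 + 1 / (2 * (β + s) ^ 2 * β * s) := ⟨_, rfl⟩
  obtain ⟨γ₀, hγ₀, hγ₀κ, hγ₀s, hlarge⟩ : ∃ γ, 0 < γ ∧ γ ≤ κ ∧ γ ≤ β * s ∧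
      1 + M * γ ^ 2 < κ * (1 / (2 * s * (β + s)) - M * γ) := by
    have e : ∀ᶠ γ in 𝓝[>] (0 : ℝ), 1 + M * γ ^ 2 < κ * (1 / (2 * s * (β + s)) - M * γ) := by
      refine nhdsWithin_le_nhds (ContinuousAt.eventually_lt (by fun_prop) (by fun_prop) ?_)
      have : 1 < κ / (2 * s * (β + s)) := (one_lt_div (by positivity)).2 hκ'
      simpa [div_eq_mul_inv] using this
    have h1 : ∀ᶠ γ in 𝓝[>] (0 : ℝ), γ ≤ κ := nhdsWithin_le_nhds (Iic_mem_nhds hκ0)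
    have h2 : ∀ᶠ γ in 𝓝[>] (0 : ℝ), γ ≤ β * s :=
      nhdsWithin_le_nhds (Iic_mem_nhds (mul_pos hβ hspos))
    exact (eventually_mem_nhdsWithin.and (h1.and (h2.and e))).exists
  have hstart : 0 ≤ κ * N γ₀ - γ₀ * Z γ₀ := by
    obtain ⟨h1, h2⟩ := integral_cos_mul_bounds (hw γ₀ hγ₀.le) fun x =>
      abs_exp_neg_sub_le_of_periodic_solution hβ hspos (hC2 γ₀ hγ₀.le) (hper γ₀ hγ₀.le)
        (hODE γ₀ hγ₀.le) ((abs_of_pos hγ₀).trans_le hγ₀s) x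
    rw [← hM] at h1 h2
    rw [← hZ] at h2
    have h3 := mul_le_mul_of_nonneg_left h1 hκ0.le
    have h4 := mul_le_mul_of_nonneg_left h2 hγ₀.le
    have h5 := mul_lt_mul_of_pos_left hlarge (show 0 < 2 * π * γ₀ by positivity)
    have h6 : 2 * π * γ₀ * (κ * (1 / (2 * s * (β + s)) - M * γ₀))
        = κ * (π * (γ₀ / (s * (β + s))) - 2 * π * (M * γ₀ ^ 2)) := by
      field_simp
    rw [h6] at h5
    linarith
  have hend : κ * N κ - κ * Z κ ≤ 0 := by
    have := integral_cos_mul_le (hw κ hκ0.le) fun x => (exp_pos _).le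
    rw [← hZ] at this
    linarith [mul_le_mul_of_nonneg_left this hκ0.le]
  obtain ⟨γs, ⟨h1, h2⟩, h3⟩ := intermediate_value_Icc' hγ₀κ
    (f := fun γ => κ * N (max γ 0) - γ * Z (max γ 0))
    ((hNcont.const_mul κ).sub (continuous_id.mul hZcont)).continuousOn (show (0 : ℝ) ∈ Set.Icc _ _ by
      simpa only [max_eq_left hγ₀.le, max_eq_left hκ0.le] using ⟨hend, hstart⟩)
  have hγs : 0 < γs := hγ₀.trans_le h1
  simp only [max_eq_left hγs.le] at h3
  have hZs := (hZpos γs hγs.le).ne'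
  refine ⟨γs, hγs, h2, ?_, ?_, by positivity⟩
  · rw [hF, div_eq_iff hZs]
    linarith
  · rw [div_eq_div_iff hZs hκ0.ne']
    linarith
end

section
/- Let β > 0 and σ > 0. As γ → ∞, the probability measures μ^γ converge weakly to the Dirac measure at 0: for every continuous 2π-periodic function f : ℝ → ℝ, ∫_{−π}^{π} f(x) μ^γ(dx) → f(0) as γ → ∞. -/
open Real MeasureTheory Filter Topology
open Set intervalIntegral

/-- Second-order necessary condition at an interior local maximum. -/
lemma IsLocalMax.deriv_deriv_nonpos {g : ℝ → ℝ} {x : ℝ} (h : IsLocalMax g x)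
    (hc : ContinuousAt g x) : deriv (deriv g) x ≤ 0 := by
  by_contra! hpos
  have hmin := isLocalMin_of_deriv_deriv_pos hpos h.deriv_eq_zero hc
  have heq : g =ᶠ[𝓝 x] fun _ => g x := by
    filter_upwards [h, hmin] with y h₁ h₂ using le_antisymm h₁ h₂
  have hzero : deriv (deriv g) x = 0 := by
    rw [heq.deriv.deriv_eq]
    simp
  exact hpos.ne' hzero

lemma IsMaxOn.deriv_left_nonpos {g : ℝ → ℝ} {a b g' : ℝ} (hab : a < b)
    (h : IsMaxOn g (Icc a b) a) (hg : HasDerivAt g g' a) : g' ≤ 0 := by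
  have hcone : b - a ∈ posTangentConeAt (Icc a b) a :=
    sub_mem_posTangentConeAt_of_segment_subset (segment_eq_Icc hab.le ▸ Subset.rfl)
  have := h.localize.hasFDerivWithinAt_nonpos hg.hasFDerivAt.hasFDerivWithinAt hcone
  simp at this
  nlinarith

lemma IsMaxOn.deriv_right_nonneg {g : ℝ → ℝ} {a b g' : ℝ} (hab : a < b)
    (h : IsMaxOn g (Icc a b) b) (hg : HasDerivAt g g' b) : 0 ≤ g' := by
  have hcone : a - b ∈ posTangentConeAt (Icc a b) b :=
    sub_mem_posTangentConeAt_of_segment_subset (by rw [segment_symm, segment_eq_Icc hab.le])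
  have := h.localize.hasFDerivWithinAt_nonpos hg.hasFDerivAt.hasFDerivWithinAt hcone
  simp at this
  nlinarith

section HamiltonJacobi

variable {β σ γ : ℝ} {v : ℝ → ℝ}

lemma Function.Periodic.deriv_add_period {T : ℝ} (hper : Function.Periodic v T) :
    Function.Periodic (deriv v) T := by
  intro x
  rw [← deriv_comp_add_const]
  congr 1
  exact funext hper

/-- Comparison with the function `4 √γ (1 - cos (x / 2))`, whose concave kink at `π` cannot be a
point where its difference with a smooth function is maximal. -/
lemma kuramoto_upper_bound (hβ : 0 < β) (hγ : 0 ≤ γ)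
    (hper : Function.Periodic v (2 * π)) (hC2 : ContDiff ℝ 2 v)
    (hODE : ∀ x : ℝ, β * v x - σ ^ 2 / 2 * deriv (deriv v) x + (1 / 2) * (deriv v x) ^ 2
      = -γ * Real.cos x) {x : ℝ} (hx : x ∈ Icc (-π) π) :
    β * v x + γ ≤ (σ ^ 2 / 2 + 4 * β) * √γ := by
  obtain ⟨s, hs⟩ : ∃ s, s = √γ := ⟨_, rfl⟩
  have hs0 : 0 ≤ s := hs ▸ Real.sqrt_nonneg γ
  have hsq : s ^ 2 = γ := hs ▸ Real.sq_sqrt hγ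
  rw [← hs]
  have hπ := Real.pi_pos
  have hv1 : ∀ y, HasDerivAt v (deriv v y) y := fun y =>
    (hC2.differentiable (by norm_num) y).hasDerivAt
  have hv2 : ∀ y, HasDerivAt (deriv v) (deriv (deriv v) y) y := fun y =>
    ((hC2.differentiable_deriv_two) y).hasDerivAt
  set g : ℝ → ℝ := fun y => v y + 4 * s * Real.cos (y / 2) with hgdef
  have hg1 : ∀ y, HasDerivAt g (deriv v y - 2 * s * Real.sin (y / 2)) y := fun y => by
    have := (hv1 y).add ((((hasDerivAt_id y).div_const 2).cos).const_mul (4 * s))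
    refine this.congr_deriv ?_
    simp only [id]
    ring
  have hdg : deriv g = fun y => deriv v y - 2 * s * Real.sin (y / 2) :=
    funext fun y => (hg1 y).deriv
  have hg2 : ∀ y, deriv (deriv g) y = deriv (deriv v) y - s * Real.cos (y / 2) := fun y => by
    have := (hv2 y).sub ((((hasDerivAt_id y).div_const 2).sin).const_mul (2 * s))
    rw [hdg]
    refine (this.congr_deriv ?_).deriv
    simp
    ring
  have hgc : Continuous g := continuous_iff_continuousAt.2 fun y => (hg1 y).continuousAt
  obtain ⟨z, hz, hmax⟩ := isCompact_Icc.exists_isMaxOn (s := Icc (-π) π) ⟨x, hx⟩ hgc.continuousOn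
  have hle : v x ≤ v z + 4 * s := by
    have h1 : v x + 4 * s * Real.cos (x / 2) ≤ v z + 4 * s * Real.cos (z / 2) := hmax hx
    have h2 : 0 ≤ Real.cos (x / 2) :=
      Real.cos_nonneg_of_neg_pi_div_two_le_of_le (by linarith [hx.1]) (by linarith [hx.2])
    have h3 := Real.cos_le_one (z / 2)
    nlinarith [mul_nonneg hs0 h2, mul_le_mul_of_nonneg_left h3 hs0]
  suffices hcrit : β * v z + γ ≤ σ ^ 2 / 2 * s by
    nlinarith [mul_le_mul_of_nonneg_left hle hβ.le]
  have hinterior : deriv v z = 2 * s * Real.sin (z / 2) →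
      deriv (deriv v) z ≤ s * Real.cos (z / 2) → β * v z + γ ≤ σ ^ 2 / 2 * s := by
    intro h1 h2
    have h3 := hODE z
    have h4 : Real.cos z = 1 - 2 * Real.sin (z / 2) ^ 2 := by
      have h5 := Real.cos_two_mul (z / 2)
      have h6 := Real.sin_sq_add_cos_sq (z / 2)
      rw [mul_div_cancel₀ z two_ne_zero] at h5
      linarith
    rw [h1, h4, ← hsq] at h3
    rw [← hsq]
    have h5 : deriv (deriv v) z ≤ s := by
      nlinarith [mul_le_mul_of_nonneg_left (Real.cos_le_one (z / 2)) hs0]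
    nlinarith [mul_le_mul_of_nonneg_left h5 (by positivity : 0 ≤ σ ^ 2 / 2)]
  by_cases hzi : z ∈ Ioo (-π) π
  · have hloc : IsLocalMax g z := hmax.isLocalMax (Icc_mem_nhds hzi.1 hzi.2)
    have h1 := hloc.deriv_eq_zero
    have h2 := hloc.deriv_deriv_nonpos hgc.continuousAt
    rw [(hg1 z).deriv] at h1
    rw [hg2] at h2
    exact hinterior (by linarith) (by linarith)
  · have hends : z = -π ∨ z = π := by
      by_contra! hne
      exact hzi ⟨lt_of_le_of_ne hz.1 hne.1.symm, lt_of_le_of_ne hz.2 hne.2⟩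
    have hvπ : v (-π) = v π := by
      have := hper (-π)
      rwa [show -π + 2 * π = π by ring, eq_comm] at this
    have hdvπ : deriv v (-π) = deriv v π := by
      have := hper.deriv_add_period (-π)
      rwa [show -π + 2 * π = π by ring, eq_comm] at this
    have hgπ : g (-π) = g π := by
      simp [hgdef, hvπ, neg_div]
    have hmaxr : IsMaxOn g (Icc (-π) π) π := by
      rcases hends with rfl | rfl
      · exact fun y hy => (hmax hy).trans_eq hgπ
      · exact hmax
    have hmaxl : IsMaxOn g (Icc (-π) π) (-π) := fun y hy => (hmaxr hy).trans_eq hgπ.symm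
    have hr := hmaxr.deriv_right_nonneg (by linarith) (hg1 π)
    have hl := hmaxl.deriv_left_nonpos (by linarith) (hg1 (-π))
    simp only [neg_div, Real.sin_neg, Real.sin_pi_div_two, hdvπ] at hr hl
    have hs_zero : s = 0 := by linarith
    have hd0 : deriv v π = 0 := by subst hs_zero; linarith
    -- only the degenerate case `γ = 0` is left, where `g = v` is periodic
    have hgv : g = v := by simp [hgdef, hs_zero]
    have hmaxv : ∀ y, v y ≤ v z := by
      intro y
      obtain ⟨w, hw, hyw⟩ := hper.exists_mem_Ico (by positivity) y (-π)
      rw [hyw, ← hgv]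
      exact hmax ⟨hw.1, by linarith [hw.2]⟩
    have hloc : IsLocalMax v z := Eventually.of_forall hmaxv
    refine hinterior ?_ ?_
    · rw [hs_zero, hloc.deriv_eq_zero]; ring
    · rw [hs_zero, zero_mul]; exact hloc.deriv_deriv_nonpos hC2.continuous.continuousAt

/-- The identity `∫ (β v + γ cos) e^{-2v/σ²} = ½ ∫ (v')² e^{-2v/σ²}` obtained by integrating
the derivative of `v' e^{-2v/σ²}` over a period, stated as an inequality. -/
lemma kuramoto_energy_nonneg (hσ : 0 < σ)
    (hper : Function.Periodic v (2 * π)) (hC2 : ContDiff ℝ 2 v)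
    (hODE : ∀ x : ℝ, β * v x - σ ^ 2 / 2 * deriv (deriv v) x + (1 / 2) * (deriv v x) ^ 2
      = -γ * Real.cos x) :
    0 ≤ ∫ x in (-π)..π, (β * v x + γ * Real.cos x) * Real.exp (-(2 / σ ^ 2) * v x) := by
  have hπ := Real.pi_pos
  have hvc := hC2.continuous
  have hv'c : Continuous (deriv v) := hC2.continuous_deriv (by norm_num)
  have hv1 : ∀ y, HasDerivAt v (deriv v y) y := fun y =>
    (hC2.differentiable (by norm_num) y).hasDerivAt
  have hv2 : ∀ y, HasDerivAt (deriv v) (deriv (deriv v) y) y := fun y =>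
    ((hC2.differentiable_deriv_two) y).hasDerivAt
  have hdv : ∀ y, deriv (deriv v) y
      = 2 / σ ^ 2 * (β * v y + γ * Real.cos y + (1 / 2) * (deriv v y) ^ 2) := fun y => by
    have := hODE y
    field_simp
    linarith
  have hder : ∀ y, HasDerivAt (fun x => deriv v x * Real.exp (-(2 / σ ^ 2) * v x))
      (2 / σ ^ 2 * ((β * v y + γ * Real.cos y) * Real.exp (-(2 / σ ^ 2) * v y)
        - (1 / 2) * (deriv v y) ^ 2 * Real.exp (-(2 / σ ^ 2) * v y))) y := fun y => by
    refine ((hv2 y).mul ((hv1 y).const_mul (-(2 / σ ^ 2))).exp).congr_deriv ?_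
    rw [hdv]
    ring
  have hI1 : IntervalIntegrable
      (fun x => (β * v x + γ * Real.cos x) * Real.exp (-(2 / σ ^ 2) * v x)) volume (-π) π :=
    Continuous.intervalIntegrable (by fun_prop) _ _
  have hI2 : IntervalIntegrable
      (fun x => (1 / 2) * (deriv v x) ^ 2 * Real.exp (-(2 / σ ^ 2) * v x)) volume (-π) π :=
    Continuous.intervalIntegrable (by fun_prop) _ _
  have hint := integral_eq_sub_of_hasDerivAt (a := -π) (b := π) (fun y _ => hder y)
    ((hI1.sub hI2).const_mul _)
  have hvπ : v (-π) = v π := by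
    have := hper (-π)
    rwa [show -π + 2 * π = π by ring, eq_comm] at this
  have hdvπ : deriv v (-π) = deriv v π := by
    have := hper.deriv_add_period (-π)
    rwa [show -π + 2 * π = π by ring, eq_comm] at this
  rw [intervalIntegral.integral_const_mul, intervalIntegral.integral_sub hI1 hI2, hvπ, hdvπ,
    sub_self, mul_eq_zero, or_iff_right (by positivity)] at hint
  have hnn : 0 ≤ ∫ x in (-π)..π, (1 / 2) * (deriv v x) ^ 2 * Real.exp (-(2 / σ ^ 2) * v x) :=
    intervalIntegral.integral_nonneg (by linarith) fun x _ => by positivity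
  linarith

lemma kuramoto_moment_bound (hβ : 0 < β) (hσ : 0 < σ) (hγ : 0 < γ)
    (hper : Function.Periodic v (2 * π)) (hC2 : ContDiff ℝ 2 v)
    (hODE : ∀ x : ℝ, β * v x - σ ^ 2 / 2 * deriv (deriv v) x + (1 / 2) * (deriv v x) ^ 2
      = -γ * Real.cos x) :
    ∫ x in (-π)..π, (1 - Real.cos x) * Real.exp (-(2 / σ ^ 2) * v x)
      ≤ (σ ^ 2 / 2 + 4 * β) / √γ * ∫ x in (-π)..π, Real.exp (-(2 / σ ^ 2) * v x) := by
  have hπ := Real.pi_pos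
  have hvc := hC2.continuous
  have hs : 0 < √γ := Real.sqrt_pos.2 hγ
  have hsq : √γ * √γ = γ := Real.mul_self_sqrt hγ.le
  have hen := kuramoto_energy_nonneg hσ hper hC2 hODE
  have hmono : ∫ x in (-π)..π, (β * v x + γ * Real.cos x) * Real.exp (-(2 / σ ^ 2) * v x)
      ≤ ∫ x in (-π)..π, ((σ ^ 2 / 2 + 4 * β) * √γ * Real.exp (-(2 / σ ^ 2) * v x)
        - γ * ((1 - Real.cos x) * Real.exp (-(2 / σ ^ 2) * v x))) := by
    refine intervalIntegral.integral_mono_on (by linarith)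
      (Continuous.intervalIntegrable (by fun_prop) _ _)
      (Continuous.intervalIntegrable (by fun_prop) _ _) fun x hx => ?_
    have hub := kuramoto_upper_bound hβ hγ.le hper hC2 hODE hx
    have := mul_le_mul_of_nonneg_right hub (Real.exp_pos (-(2 / σ ^ 2) * v x)).le
    linarith
  rw [intervalIntegral.integral_sub (Continuous.intervalIntegrable (by fun_prop) _ _)
    (Continuous.intervalIntegrable (by fun_prop) _ _), intervalIntegral.integral_const_mul,
    intervalIntegral.integral_const_mul] at hmono
  have hle := hen.trans hmono
  rw [div_mul_eq_mul_div, le_div_iff₀ hs]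
  refine le_of_mul_le_mul_right ?_ hs
  rw [mul_assoc, hsq]
  linarith

end HamiltonJacobi

/-- A continuous function on `[-π, π]` differs from its value at `0` by at most `ε` plus a
multiple of `1 - cos`. -/
lemma Continuous.exists_abs_sub_le_add_mul_one_sub_cos {f : ℝ → ℝ} (hf : Continuous f)
    {ε : ℝ} (hε : 0 < ε) :
    ∃ M, 0 ≤ M ∧ ∀ x ∈ Icc (-π) π, |f x - f 0| ≤ ε + M * (1 - Real.cos x) := by
  obtain ⟨δ, hδ, hclose⟩ := Metric.continuousAt_iff.1 hf.continuousAt ε hε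
  obtain ⟨B, hB⟩ := (isCompact_Icc (a := -π) (b := π)).exists_bound_of_continuousOn
    (f := fun x => f x - f 0) (by fun_prop)
  have hπ := Real.pi_pos
  have hB0 : 0 ≤ B := (norm_nonneg _).trans (hB 0 ⟨by linarith, by linarith⟩)
  set d := min δ π
  have hd : 0 < d := lt_min hδ hπ
  have hcos : 0 < 1 - Real.cos d := by
    have := Real.cos_lt_cos_of_nonneg_of_le_pi le_rfl (min_le_right δ π) hd
    rw [Real.cos_zero] at this
    linarith
  refine ⟨B / (1 - Real.cos d), by positivity, fun x hx => ?_⟩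
  have hx1 : 0 ≤ 1 - Real.cos x := by linarith [Real.cos_le_one x]
  rcases lt_or_ge |x| d with hxd | hxd
  · have := hclose (x := x) (by rw [Real.dist_eq, sub_zero]; exact hxd.trans_le (min_le_left _ _))
    rw [Real.dist_eq] at this
    have h2 : 0 ≤ B / (1 - Real.cos d) * (1 - Real.cos x) := by positivity
    linarith
  · have h1 := Real.cos_le_cos_of_nonneg_of_le_pi hd.le (abs_le.2 hx) hxd
    rw [Real.cos_abs] at h1
    have h2 : B ≤ B / (1 - Real.cos d) * (1 - Real.cos x) := by
      rw [div_mul_eq_mul_div, le_div_iff₀ hcos]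
      exact mul_le_mul_of_nonneg_left (by linarith) hB0
    have h3 := hB x hx
    rw [Real.norm_eq_abs] at h3
    linarith

/-- As `γ → ∞`, the measures `μ^γ` converge weakly to the Dirac mass
at `0`: for every continuous `2π`-periodic `f`, `∫ f dμ^γ → f 0`. -/
theorem kuramoto_mu_gamma_tendsto_dirac
    (β σ : ℝ) (hβ : 0 < β) (hσ : 0 < σ)
    (v : ℝ → ℝ → ℝ)
    (hper : ∀ γ, 0 ≤ γ → Function.Periodic (v γ) (2 * π))
    (hC2 : ∀ γ, 0 ≤ γ → ContDiff ℝ 2 (v γ))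
    (hODE : ∀ γ, 0 ≤ γ → ∀ x : ℝ,
      β * v γ x - σ ^ 2 / 2 * deriv (deriv (v γ)) x + (1 / 2) * (deriv (v γ) x) ^ 2
        = -γ * Real.cos x)
    (Z : ℝ → ℝ)
    (hZ : ∀ γ, Z γ = ∫ y in (-π)..π, Real.exp (-(2 / σ ^ 2) * v γ y)) :
    ∀ f : ℝ → ℝ, Continuous f → Function.Periodic f (2 * π) →
      Tendsto
        (fun γ : ℝ => (∫ x in (-π)..π, f x * Real.exp (-(2 / σ ^ 2) * v γ x)) / Z γ)
        atTop (𝓝 (f 0)) := by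
  intro f hf _
  have hπ := Real.pi_pos
  rw [Metric.tendsto_nhds]
  intro ε hε
  obtain ⟨M, hM, hfM⟩ := hf.exists_abs_sub_le_add_mul_one_sub_cos (half_pos hε)
  have hlim : Tendsto (fun γ : ℝ => M * ((σ ^ 2 / 2 + 4 * β) / √γ)) atTop (𝓝 0) := by
    simpa using (Real.tendsto_sqrt_atTop.const_div_atTop (σ ^ 2 / 2 + 4 * β)).const_mul M
  filter_upwards [hlim.eventually_lt_const (half_pos hε), eventually_gt_atTop 0] with γ hsmall hγ
  have hvc := (hC2 γ hγ.le).continuous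
  have hmom := kuramoto_moment_bound hβ hσ hγ (hper γ hγ.le) (hC2 γ hγ.le) (hODE γ hγ.le)
  rw [← hZ] at hmom
  have hZpos : 0 < Z γ := by
    rw [hZ]
    exact intervalIntegral.intervalIntegral_pos_of_pos
      (Continuous.intervalIntegrable (by fun_prop) _ _) (fun x => Real.exp_pos _) (by linarith)
  have hsub : (∫ x in (-π)..π, f x * Real.exp (-(2 / σ ^ 2) * v γ x)) - f 0 * Z γ
      = ∫ x in (-π)..π, (f x - f 0) * Real.exp (-(2 / σ ^ 2) * v γ x) := by
    rw [hZ, ← intervalIntegral.integral_const_mul, ← intervalIntegral.integral_sub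
      (Continuous.intervalIntegrable (by fun_prop) _ _)
      (Continuous.intervalIntegrable (by fun_prop) _ _)]
    simp only [sub_mul]
  have hbound : |∫ x in (-π)..π, (f x - f 0) * Real.exp (-(2 / σ ^ 2) * v γ x)|
      ≤ ε / 2 * Z γ
        + M * ∫ x in (-π)..π, (1 - Real.cos x) * Real.exp (-(2 / σ ^ 2) * v γ x) := by
    rw [hZ, ← intervalIntegral.integral_const_mul, ← intervalIntegral.integral_const_mul,
      ← intervalIntegral.integral_add (Continuous.intervalIntegrable (by fun_prop) _ _)
      (Continuous.intervalIntegrable (by fun_prop) _ _)]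
    refine (intervalIntegral.abs_integral_le_integral_abs (by linarith)).trans
      (intervalIntegral.integral_mono_on (by linarith)
        (Continuous.intervalIntegrable (by fun_prop) _ _)
        (Continuous.intervalIntegrable (by fun_prop) _ _) fun x hx => ?_)
    rw [abs_mul, abs_of_pos (Real.exp_pos _)]
    have := mul_le_mul_of_nonneg_right (hfM x hx) (Real.exp_pos (-(2 / σ ^ 2) * v γ x)).le
    linarith
  rw [Real.dist_eq, div_sub' hZpos.ne', mul_comm (Z γ), hsub, abs_div, abs_of_pos hZpos,
    div_lt_iff₀ hZpos]
  have h1 := mul_le_mul_of_nonneg_left hmom hM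
  have h2 := mul_lt_mul_of_pos_right hsmall hZpos
  linarith
end

section
/- Let β > 0 and σ > 0, and for γ > 0 set w^γ(x) := (v^γ(x) + γ/β)/√γ. Then, as γ → ∞, the functions w^γ(·) − w^γ(0) converge uniformly on [0, 2π] to the function w(x) := 4(1 − |cos(x/2)|), i.e. sup_{x ∈ [0,2π]} |(w^γ(x) − w^γ(0)) − 4(1 − |cos(x/2)|)| → 0 as γ → ∞. -/
open Real MeasureTheory Filter Topology

/-- A twice differentiable periodic function attains its maximum, with the usual first- and
second-order conditions. -/
lemma exists_periodic_max_second_order {F F' F'' : ℝ → ℝ} {T : ℝ} (hT : 0 < T)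
    (hper : Function.Periodic F T) (hF : ∀ x, HasDerivAt F (F' x) x)
    (hF' : ∀ x, HasDerivAt F' (F'' x) x) :
    ∃ x₀, (∀ x, F x ≤ F x₀) ∧ F' x₀ = 0 ∧ F'' x₀ ≤ 0 := by
  have hcont : Continuous F := continuous_iff_continuousAt.2 fun x => (hF x).continuousAt
  obtain ⟨x₀, -, hmax⟩ := isCompact_Icc.exists_isMaxOn (s := Set.Icc 0 T)
    ⟨0, le_refl 0, hT.le⟩ hcont.continuousOn
  have hglobal : ∀ x, F x ≤ F x₀ := by
    intro x
    obtain ⟨y, hy, hxy⟩ := hper.exists_mem_Ico₀ hT x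
    rw [hxy]
    exact hmax ⟨hy.1, hy.2.le⟩
  have hlocmax : IsLocalMax F x₀ := Eventually.of_forall hglobal
  have hd : deriv F = F' := funext fun x => (hF x).deriv
  have hdd : deriv (deriv F) = F'' := by
    rw [hd]
    exact funext fun x => (hF' x).deriv
  have hzero : F' x₀ = 0 := hlocmax.hasDerivAt_eq_zero (hF x₀)
  refine ⟨x₀, hglobal, hzero, ?_⟩
  by_contra! hpos
  have hlocmin : IsLocalMin F x₀ := isLocalMin_of_deriv_deriv_pos (by rwa [hdd])
    (by rw [hd, hzero]) hcont.continuousAt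
  have hconst : F =ᶠ[𝓝 x₀] fun _ => F x₀ := by
    filter_upwards [hlocmin] with x hx using le_antisymm (hglobal x) hx
  have hderiv : deriv (deriv F) x₀ = 0 := by
    rw [hconst.deriv.deriv_eq]
    simp
  rw [hdd] at hderiv
  exact hpos.ne' hderiv

lemma cos_eq_one_sub_sin_half_sq (x : ℝ) : cos x = 1 - 2 * sin (x / 2) ^ 2 := by
  have h := cos_two_mul (x / 2)
  rw [mul_div_cancel₀ x two_ne_zero] at h
  linarith [sin_sq_add_cos_sq (x / 2)]

lemma hasDerivAt_sin_half (x : ℝ) :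
    HasDerivAt (fun x : ℝ => sin (x / 2)) (cos (x / 2) / 2) x := by
  refine ((hasDerivAt_id' x).div_const 2).sin.congr_deriv ?_
  ring

lemma hasDerivAt_cos_half (x : ℝ) :
    HasDerivAt (fun x : ℝ => cos (x / 2)) (-sin (x / 2) / 2) x := by
  refine ((hasDerivAt_id' x).div_const 2).cos.congr_deriv ?_
  ring

lemma hasDerivAt_sqrt_cos_half_sq_add {η : ℝ} (hη : 0 < η) (x : ℝ) :
    HasDerivAt (fun x : ℝ => √(cos (x / 2) ^ 2 + η ^ 2))
      (-(cos (x / 2) * sin (x / 2)) / (2 * √(cos (x / 2) ^ 2 + η ^ 2))) x := by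
  have hpos : 0 < cos (x / 2) ^ 2 + η ^ 2 := by positivity
  refine ((((hasDerivAt_cos_half x).fun_pow 2).add_const (η ^ 2)).sqrt hpos.ne').congr_deriv ?_
  push_cast
  ring

lemma hasDerivAt_cos_mul_sin_half_div_sqrt {η : ℝ} (hη : 0 < η) (x : ℝ) :
    HasDerivAt (fun x : ℝ => 2 * (cos (x / 2) * sin (x / 2)) / √(cos (x / 2) ^ 2 + η ^ 2))
      (((1 + η ^ 2) * (1 - 2 * sin (x / 2) ^ 2) + sin (x / 2) ^ 4)
        / √(cos (x / 2) ^ 2 + η ^ 2) ^ 3) x := by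
  have hpos : 0 < cos (x / 2) ^ 2 + η ^ 2 := by positivity
  have hr := sqrt_pos.2 hpos
  have hsq := sq_sqrt hpos.le
  have hd := hasDerivAt_sqrt_cos_half_sq_add hη x
  refine ((((hasDerivAt_cos_half x).fun_mul (hasDerivAt_sin_half x)).const_mul 2).div
    hd hr.ne').congr_deriv ?_
  set r := √(cos (x / 2) ^ 2 + η ^ 2)
  have hc2 := cos_sq' (x / 2)
  field_simp
  have hr2 : r ^ 2 = 1 - sin (x / 2) ^ 2 + η ^ 2 := by rw [hsq, hc2]
  rw [hr2, hc2]
  ring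

lemma one_div_sub_curvature_le {η S r A : ℝ} (hη : 0 < η) (hS0 : 0 ≤ S)
    (hr : η ≤ r) (hrA : r ≤ A) (hA1 : 1 ≤ A) :
    1 / A - (A ^ 2 * (1 - 2 * S) + S ^ 2) / r ^ 3 ≤ 2 * S * (1 + A ^ 2 / η ^ 3) := by
  have hr0 : 0 < r := hη.trans_le hr
  have hA0 : 0 < A := by linarith
  have hA : 1 / A ≤ 1 := by rw [div_le_one hA0]; exact hA1
  have hη3 : 0 ≤ A ^ 2 / η ^ 3 := by positivity
  have hSr : A ^ 2 * (1 - 2 * S) / r ^ 3 ≤ (A ^ 2 * (1 - 2 * S) + S ^ 2) / r ^ 3 := by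
    gcongr
    nlinarith
  rcases le_total 0 (1 - 2 * S) with h | h
  · have h1 : (1 - 2 * S) * (1 / A) ≤ A ^ 2 * (1 - 2 * S) / r ^ 3 := by
      have : A ^ 2 * (1 - 2 * S) / A ^ 3 ≤ A ^ 2 * (1 - 2 * S) / r ^ 3 := by gcongr
      convert this using 1
      field_simp
    nlinarith
  · have h1 : A ^ 2 / r ^ 3 ≤ A ^ 2 / η ^ 3 := by gcongr
    have h2 : A ^ 2 * (1 - 2 * S) / r ^ 3 = (1 - 2 * S) * (A ^ 2 / r ^ 3) := by ring
    have h3 : 0 ≤ A ^ 2 / r ^ 3 := by positivity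
    nlinarith

section Solution

variable {β σ γ : ℝ} {v : ℝ → ℝ}

lemma kuramoto_solution_upper (hβ : 0 < β) (hγ : 0 < γ)
    (hper : Function.Periodic v (2 * π)) (hC2 : ContDiff ℝ 2 v)
    (hODE : ∀ x, β * v x - σ ^ 2 / 2 * deriv (deriv v) x + (1 / 2) * (deriv v x) ^ 2
      = -γ * cos x) (x : ℝ) :
    (v x + γ / β) / √γ ≤ 4 * (1 - |cos (x / 2)|) + σ ^ 2 / 2 / β := by
  have hq := sqrt_pos.2 hγ
  have hqq := sq_sqrt hγ.le
  set q := √γ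
  have hv : ∀ x, HasDerivAt v (deriv v x) x := fun x =>
    (hC2.differentiable (by norm_num) x).hasDerivAt
  have hv' : ∀ x, HasDerivAt (deriv v) (deriv (deriv v) x) x := fun x =>
    ((ContDiff.deriv' (n := 1) hC2).differentiable (by norm_num) x).hasDerivAt
  have key : ∀ x, (v x + γ / β) / q ≤ 4 * (1 - cos (x / 2)) + σ ^ 2 / 2 / β := by
    obtain ⟨y, hmax, hd, hdd⟩ := exists_periodic_max_second_order
      (F := fun x => v x - q * (4 * (1 - cos (x / 2))))
      (F' := fun x => deriv v x - q * (2 * sin (x / 2)))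
      (F'' := fun x => deriv (deriv v) x - q * cos (x / 2))
      (T := 2 * (2 * π)) (by positivity)
      (by
        intro x
        have h : v (x + 2 * (2 * π)) = v x := by simpa using hper.nat_mul 2 x
        have hx : (x + 2 * (2 * π)) / 2 = x / 2 + 2 * π := by ring
        simp only [h, hx, cos_add_two_pi])
      (by
        intro x
        refine ((hv x).sub
          ((((hasDerivAt_cos_half x).const_sub 1).const_mul 4).const_mul q)).congr_deriv ?_
        ring)
      (by
        intro x
        refine ((hv' x).sub (((hasDerivAt_sin_half x).const_mul 2).const_mul q)).congr_deriv ?_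
        ring)
    intro x
    have hx := hmax x
    have hv1 : deriv v y = q * (2 * sin (y / 2)) := by linarith
    have hode := hODE y
    rw [hv1, cos_eq_one_sub_sin_half_sq y] at hode
    have hcurv : σ ^ 2 / 2 * deriv (deriv v) y ≤ σ ^ 2 / 2 * q := by
      gcongr
      nlinarith [cos_le_one (y / 2)]
    have hW : 0 ≤ β * (q * (4 * (1 - cos (y / 2)))) := by
      have := cos_le_one (y / 2)
      have : 0 ≤ 1 - cos (y / 2) := by linarith
      positivity
    have hβF : β * (v y - q * (4 * (1 - cos (y / 2)))) ≤ -γ + σ ^ 2 / 2 * q := by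
      rw [← hqq] at hode ⊢
      linarith
    have hβx : β * (v x - q * (4 * (1 - cos (x / 2)))) ≤ -γ + σ ^ 2 / 2 * q :=
      (mul_le_mul_of_nonneg_left hx hβ.le).trans hβF
    have hγβ : β * (γ / β) = γ := by field_simp
    have hσβ : β * (σ ^ 2 / 2 / β) = σ ^ 2 / 2 := by field_simp
    rw [div_le_iff₀ hq]
    refine le_of_mul_le_mul_left ?_ hβ
    linear_combination hβx + hγβ - q * hσβ
  rcases le_total 0 (cos (x / 2)) with h | h
  · rw [abs_of_nonneg h]
    exact key x
  · rw [abs_of_nonpos h]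
    have hx : (x + 2 * π) / 2 = x / 2 + π := by ring
    simpa [hper x, hx, cos_add_pi] using key (x + 2 * π)

lemma kuramoto_solution_lower {η : ℝ} (hβ : 0 < β) (hγ : 0 < γ) (hη : 0 < η)
    (hper : Function.Periodic v (2 * π)) (hC2 : ContDiff ℝ 2 v)
    (hODE : ∀ x, β * v x - σ ^ 2 / 2 * deriv (deriv v) x + (1 / 2) * (deriv v x) ^ 2
      = -γ * cos x)
    (hlarge : (4 * β + σ ^ 2 / 2 * (2 * (1 + √(1 + η ^ 2) ^ 2 / η ^ 3))) * √(1 + η ^ 2) ^ 2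
      ≤ √γ * (2 * η ^ 2)) (x : ℝ) :
    4 * (√(1 + η ^ 2) - √(cos (x / 2) ^ 2 + η ^ 2)) + σ ^ 2 / 2 / β / √(1 + η ^ 2)
      ≤ (v x + γ / β) / √γ := by
  have hq := sqrt_pos.2 hγ
  have hqq := sq_sqrt hγ.le
  set q := √γ
  have hA2 : √(1 + η ^ 2) ^ 2 = 1 + η ^ 2 := sq_sqrt (by positivity)
  have hA1 : 1 ≤ √(1 + η ^ 2) := one_le_sqrt.2 (by nlinarith)
  set A := √(1 + η ^ 2)
  have hA0 : 0 < A := by linarith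
  have hv : ∀ x, HasDerivAt v (deriv v x) x := fun x =>
    (hC2.differentiable (by norm_num) x).hasDerivAt
  have hv' : ∀ x, HasDerivAt (deriv v) (deriv (deriv v) x) x := fun x =>
    ((ContDiff.deriv' (n := 1) hC2).differentiable (by norm_num) x).hasDerivAt
  obtain ⟨y, hmax, hd, hdd⟩ := exists_periodic_max_second_order
    (F := fun x => q * (4 * (A - √(cos (x / 2) ^ 2 + η ^ 2))) - v x)
    (F' := fun x => q * (2 * (cos (x / 2) * sin (x / 2)) / √(cos (x / 2) ^ 2 + η ^ 2))
      - deriv v x)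
    (F'' := fun x => q * (((1 + η ^ 2) * (1 - 2 * sin (x / 2) ^ 2) + sin (x / 2) ^ 4)
        / √(cos (x / 2) ^ 2 + η ^ 2) ^ 3) - deriv (deriv v) x)
    (T := 2 * π) (by positivity)
    (by
      intro x
      have hx : (x + 2 * π) / 2 = x / 2 + π := by ring
      simp only [hper x, hx, cos_add_pi, neg_sq])
    (by
      intro x
      refine (((((hasDerivAt_sqrt_cos_half_sq_add hη x).const_sub A).const_mul 4).const_mul
        q).sub (hv x)).congr_deriv ?_
      ring)
    (fun x => ((hasDerivAt_cos_mul_sin_half_div_sqrt hη x).const_mul q).sub (hv' x))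
  have hx := hmax x
  have hode := hODE y
  have hr2 : √(cos (y / 2) ^ 2 + η ^ 2) ^ 2 = cos (y / 2) ^ 2 + η ^ 2 := sq_sqrt (by positivity)
  have hrη : η ≤ √(cos (y / 2) ^ 2 + η ^ 2) :=
    le_sqrt_of_sq_le (le_add_of_nonneg_left (sq_nonneg _))
  have hrA : √(cos (y / 2) ^ 2 + η ^ 2) ≤ A := by
    refine sqrt_le_sqrt ?_
    gcongr
    exact cos_sq_le_one _
  set r := √(cos (y / 2) ^ 2 + η ^ 2)
  have hr0 : 0 < r := hη.trans_le hrη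
  have hc2 : cos (y / 2) ^ 2 = 1 - sin (y / 2) ^ 2 := by
    linarith [sin_sq_add_cos_sq (y / 2)]
  have hbend := one_div_sub_curvature_le hη (sq_nonneg (sin (y / 2))) hrη hrA hA1
  have hv1 : deriv v y = q * (2 * (cos (y / 2) * sin (y / 2)) / r) := by linarith
  rw [hv1, cos_eq_one_sub_sin_half_sq y] at hode
  rw [← pow_mul, hA2] at hbend
  rw [hA2] at hlarge
  norm_num only at hbend
  set S := sin (y / 2) ^ 2 with hS
  have hS0 : 0 ≤ S := sq_nonneg _
  set W'' := ((1 + η ^ 2) * (1 - 2 * S) + sin (y / 2) ^ 4) / r ^ 3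
  have hslope : 1 / 2 * (q * (2 * (cos (y / 2) * sin (y / 2)) / r)) ^ 2
      = γ * (2 * S - 2 * S * η ^ 2 / r ^ 2) := by
    have : (cos (y / 2) * sin (y / 2)) ^ 2 = (r ^ 2 - η ^ 2) * S := by
      rw [hr2, hS]
      ring
    rw [mul_pow, div_pow, mul_pow, this, hqq]
    field_simp
  have hcurv : σ ^ 2 / 2 * (q * W'') ≤ σ ^ 2 / 2 * deriv (deriv v) y := by
    gcongr
    linarith
  have hAr : A - r ≤ S := by nlinarith
  have hgap : 2 * S * η ^ 2 / (1 + η ^ 2) ≤ 2 * S * η ^ 2 / r ^ 2 := by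
    gcongr
    rw [← hA2]
    gcongr
  have hC : (4 * β + σ ^ 2 / 2 * (2 * (1 + (1 + η ^ 2) / η ^ 3))) * S
      ≤ q * (2 * S * η ^ 2 / (1 + η ^ 2)) := by
    have h := mul_le_mul_of_nonneg_right ((le_div_iff₀ (by positivity)).2 hlarge) hS0
    refine h.trans_eq ?_
    ring
  have hqC := mul_le_mul_of_nonneg_left
    (hC.trans (mul_le_mul_of_nonneg_left hgap hq.le)) hq.le
  have hqbend := mul_le_mul_of_nonneg_left
    (mul_le_mul_of_nonneg_left hbend (by positivity : 0 ≤ σ ^ 2 / 2)) hq.le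
  have hqAr := mul_le_mul_of_nonneg_left hAr (by positivity : 0 ≤ q * (4 * β))
  have hβF : β * (q * (4 * (A - r)) - v y) ≤ γ - q * (σ ^ 2 / 2 * (1 / A)) := by
    rw [hslope] at hode
    rw [← hqq] at hode ⊢
    linear_combination hqC + hqbend + hqAr + hcurv - hode
  have hβx := (mul_le_mul_of_nonneg_left hx hβ.le).trans hβF
  have hγβ : β * (γ / β) = γ := by field_simp
  have hσβ : β * (σ ^ 2 / 2 / β / A) = σ ^ 2 / 2 * (1 / A) := by field_simp
  rw [le_div_iff₀ hq]
  refine le_of_mul_le_mul_left ?_ hβ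
  linear_combination hβx - hγβ + q * hσβ

end Solution

/-- As `γ → ∞`, the scaled functions
`w^γ(x) := (v^γ(x) + γ/β)/√γ`, recentered at `0`, converge uniformly on `[0, 2π]` to
`w(x) = 4(1 − |cos(x/2)|)`. -/
theorem kuramoto_scaled_value_tendsto_eikonal
    (β σ : ℝ) (hβ : 0 < β) (hσ : 0 < σ)
    (v : ℝ → ℝ → ℝ)
    (hper : ∀ γ, 0 ≤ γ → Function.Periodic (v γ) (2 * π))
    (hC2 : ∀ γ, 0 ≤ γ → ContDiff ℝ 2 (v γ))
    (hODE : ∀ γ, 0 ≤ γ → ∀ x : ℝ,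
      β * v γ x - σ ^ 2 / 2 * deriv (deriv (v γ)) x + (1 / 2) * (deriv (v γ) x) ^ 2
        = -γ * Real.cos x) :
    TendstoUniformlyOn
      (fun γ : ℝ => fun x : ℝ =>
        (v γ x + γ / β) / Real.sqrt γ - (v γ 0 + γ / β) / Real.sqrt γ)
      (fun x : ℝ => 4 * (1 - |Real.cos (x / 2)|))
      atTop (Set.Icc 0 (2 * π)) := by
  rw [Metric.tendstoUniformlyOn_iff]
  intro e he
  set k := σ ^ 2 / 2 / β with hk
  have hk0 : 0 < k := by positivity
  obtain ⟨η, hη, hηe⟩ : ∃ η : ℝ, 0 < η ∧ (4 + k) * η < e :=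
    ⟨e / (2 * (4 + k)), by positivity, by field_simp; linarith⟩
  have hA2 : √(1 + η ^ 2) ^ 2 = 1 + η ^ 2 := sq_sqrt (by positivity)
  have hA1 : 1 ≤ √(1 + η ^ 2) := one_le_sqrt.2 (by nlinarith)
  have hAη : √(1 + η ^ 2) ≤ 1 + η := sqrt_le_iff.2 ⟨by positivity, by nlinarith⟩
  have hlarge := (tendsto_sqrt_atTop.atTop_mul_const (by positivity : 0 < 2 * η ^ 2)
    ).eventually_ge_atTop
    ((4 * β + σ ^ 2 / 2 * (2 * (1 + √(1 + η ^ 2) ^ 2 / η ^ 3))) * √(1 + η ^ 2) ^ 2)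
  filter_upwards [hlarge, eventually_gt_atTop 0] with γ hγlarge hγ x _
  have hupper := kuramoto_solution_upper hβ hγ (hper γ hγ.le) (hC2 γ hγ.le) (hODE γ hγ.le)
  have hlower := kuramoto_solution_lower hβ hγ hη (hper γ hγ.le) (hC2 γ hγ.le)
    (hODE γ hγ.le) hγlarge
  rw [← hk] at hupper hlower
  have hkA : k - k * η ≤ k / √(1 + η ^ 2) := by
    rw [le_div_iff₀ (by linarith)]
    have h1 : (1 - η) * √(1 + η ^ 2) ≤ 1 := by
      rcases le_total η 1 with h | h <;> nlinarith
    nlinarith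
  have hr : √(cos (x / 2) ^ 2 + η ^ 2) ≤ |cos (x / 2)| + η := by
    refine sqrt_le_iff.2 ⟨by positivity, ?_⟩
    have := abs_nonneg (cos (x / 2))
    have := sq_abs (cos (x / 2))
    nlinarith
  have hux := hupper x
  have hlx := hlower x
  have hu0 := hupper 0
  have hl0 := hlower 0
  simp only [zero_div, cos_zero, abs_one, one_pow, sub_self, mul_zero, zero_add] at hu0 hl0
  rw [dist_comm, Real.dist_eq, abs_lt]
  constructor <;> nlinarith
end

section
/- The function w(x) := 4(1 − |cos(x/2)|) on [0, 2π] is continuous, satisfies w(0) = w(2π) = 0, and is a viscosity solution (both a viscosity subsolution and a viscosity supersolution) of the Eikonal equation (1/2)(w'(x))² = 2 sin²(x/2) on (0, 2π). -/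
open Real MeasureTheory Filter Topology

/-- `w` is a viscosity subsolution of the Eikonal equation
`(1/2)(w')² = 2 sin²(x/2)` on `(0, 2π)`. -/
def IsViscSubsolutionEikonal (w : ℝ → ℝ) : Prop :=
  ∀ x₀ ∈ Set.Ioo (0 : ℝ) (2 * π), ∀ φ : ℝ → ℝ,
    ContDiffOn ℝ 1 φ (Set.Ioo (0 : ℝ) (2 * π)) →
    IsLocalMaxOn (fun x => w x - φ x) (Set.Ioo (0 : ℝ) (2 * π)) x₀ →
    (1 / 2) * (deriv φ x₀) ^ 2 ≤ 2 * Real.sin (x₀ / 2) ^ 2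

/-- `u` is a viscosity supersolution of the Eikonal equation
`(1/2)(u')² = 2 sin²(x/2)` on `(0, 2π)`. -/
def IsViscSupersolutionEikonal (u : ℝ → ℝ) : Prop :=
  ∀ x₀ ∈ Set.Ioo (0 : ℝ) (2 * π), ∀ φ : ℝ → ℝ,
    ContDiffOn ℝ 1 φ (Set.Ioo (0 : ℝ) (2 * π)) →
    IsLocalMinOn (fun x => u x - φ x) (Set.Ioo (0 : ℝ) (2 * π)) x₀ →
    (1 / 2) * (deriv φ x₀) ^ 2 ≥ 2 * Real.sin (x₀ / 2) ^ 2

theorem hasDerivAt_four_mul_one_sub_mul_cos_half (s x : ℝ) :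
    HasDerivAt (fun x : ℝ => 4 * (1 - s * Real.cos (x / 2))) (2 * s * Real.sin (x / 2)) x := by
  have h := ((((hasDerivAt_id x).div_const 2).cos.const_mul s).const_sub 1).const_mul 4
  refine h.congr_deriv ?_
  simp only [id]
  ring

theorem IsLocalMax.abs_deriv_le_of_abs_sub {φ : ℝ → ℝ} {C a : ℝ}
    (hφ : DifferentiableAt ℝ φ a)
    (h : IsLocalMax (fun x => -(C * |x - a|) - φ x) a) : |deriv φ a| ≤ C := by
  have hlin : HasDerivAt (fun x : ℝ => C * (x - a)) C a := by
    simpa using ((hasDerivAt_id a).sub_const a).const_mul C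
  have hright : IsLocalMaxOn (fun x => -(C * (x - a)) - φ x) (Set.Ici a) a := by
    refine (h.on (Set.Ici a)).congr ?_ (by simp)
    filter_upwards [self_mem_nhdsWithin] with x hx
    rw [abs_of_nonneg (sub_nonneg.2 hx)]
  have hleft : IsLocalMaxOn (fun x => C * (x - a) - φ x) (Set.Iic a) a := by
    refine (h.on (Set.Iic a)).congr ?_ (by simp)
    filter_upwards [self_mem_nhdsWithin] with x hx
    rw [abs_of_nonpos (sub_nonpos.2 hx)]
    ring
  have h₁ := hright.hasFDerivWithinAt_nonpos
    (hlin.neg.sub hφ.hasDerivAt).hasFDerivAt.hasFDerivWithinAt (y := 1)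
    (mem_posTangentConeAt_of_segment_subset <| (convex_Ici a).segment_subset (by simp) (by simp))
  have h₂ := hleft.hasFDerivWithinAt_nonpos
    (hlin.sub hφ.hasDerivAt).hasFDerivAt.hasFDerivWithinAt (y := -1)
    (mem_posTangentConeAt_of_segment_subset <| (convex_Iic a).segment_subset (by simp) (by simp))
  simp at h₁ h₂
  exact abs_le.2 ⟨by linarith, by linarith⟩

theorem exists_sign_mul_eq_abs (c : ℝ) : ∃ s : ℝ, s ^ 2 = 1 ∧ |s| = 1 ∧ s * c = |c| := by
  rcases le_total 0 c with hc | hc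
  · exact ⟨1, by simp, by simp, by simp [abs_of_nonneg hc]⟩
  · exact ⟨-1, by simp, by simp, by simp [abs_of_nonpos hc]⟩

theorem isViscSupersolutionEikonal_four_mul_one_sub_abs_cos_half :
    IsViscSupersolutionEikonal (fun x : ℝ => 4 * (1 - |Real.cos (x / 2)|)) := by
  intro x₀ hx₀ φ hφ hmin
  have hnhds := isOpen_Ioo.mem_nhds hx₀
  have hd := ((hφ.differentiableOn one_ne_zero).differentiableAt hnhds).hasDerivAt
  obtain ⟨s, hs, hs', hsc⟩ := exists_sign_mul_eq_abs (Real.cos (x₀ / 2))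
  have hloc : IsLocalMin (fun x => 4 * (1 - s * Real.cos (x / 2)) - φ x) x₀ := by
    filter_upwards [hmin.isLocalMin hnhds] with x hx
    have hle : s * Real.cos (x / 2) ≤ |Real.cos (x / 2)| := by
      simpa [abs_mul, hs'] using le_abs_self (s * Real.cos (x / 2))
    rw [hsc]
    linarith
  have h := hloc.hasDerivAt_eq_zero ((hasDerivAt_four_mul_one_sub_mul_cos_half s x₀).sub hd)
  rw [← sub_eq_zero.1 h, mul_pow, mul_pow, hs]
  linarith

theorem isViscSubsolutionEikonal_four_mul_one_sub_abs_cos_half :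
    IsViscSubsolutionEikonal (fun x : ℝ => 4 * (1 - |Real.cos (x / 2)|)) := by
  intro x₀ hx₀ φ hφ hmax
  have hnhds := isOpen_Ioo.mem_nhds hx₀
  have hdiff := (hφ.differentiableOn one_ne_zero).differentiableAt hnhds
  have hmax' := hmax.isLocalMax hnhds
  by_cases hc : Real.cos (x₀ / 2) = 0
  · have hsin : Real.sin (x₀ / 2) ^ 2 = 1 := by
      simpa [hc] using Real.sin_sq_add_cos_sq (x₀ / 2)
    have hloc : IsLocalMax (fun x => -(2 * |x - x₀|) - φ x) x₀ := by
      filter_upwards [hmax'] with x hx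
      have hle : |Real.cos (x / 2)| ≤ |x - x₀| / 2 := by
        have := Real.abs_cos_sub_cos_le (x / 2) (x₀ / 2)
        rwa [hc, sub_zero, ← sub_div, abs_div, abs_two] at this
      simp only [hc, abs_zero, sub_self, mul_zero] at hx ⊢
      linarith
    have h := sq_le_sq' (abs_le.1 (hloc.abs_deriv_le_of_abs_sub hdiff)).1
      (abs_le.1 (hloc.abs_deriv_le_of_abs_sub hdiff)).2
    rw [hsin]
    linarith
  · obtain ⟨s, hs, hs', hsc⟩ := exists_sign_mul_eq_abs (Real.cos (x₀ / 2))
    have hpos : ∀ᶠ x in 𝓝 x₀, 0 < s * Real.cos (x / 2) := by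
      have hcont : Continuous fun x : ℝ => s * Real.cos (x / 2) := by fun_prop
      exact hcont.continuousAt.eventually_const_lt (by simpa only [hsc] using abs_pos.2 hc)
    have hloc : IsLocalMax (fun x => 4 * (1 - s * Real.cos (x / 2)) - φ x) x₀ := by
      filter_upwards [hmax', hpos] with x hx hx'
      have heq : |Real.cos (x / 2)| = s * Real.cos (x / 2) := by
        rw [← abs_of_pos hx', abs_mul, hs', one_mul]
      rw [hsc, ← heq]
      exact hx
    have h := hloc.hasDerivAt_eq_zero
      ((hasDerivAt_four_mul_one_sub_mul_cos_half s x₀).sub hdiff.hasDerivAt)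
    rw [← sub_eq_zero.1 h, mul_pow, mul_pow, hs]
    linarith

/-- The function `w(x) = 4(1 − |cos(x/2)|)` is continuous, vanishes at
`0` and `2π`, and is a viscosity solution of the Eikonal equation
`(1/2)(w')² = 2 sin²(x/2)` on `(0, 2π)`. -/
theorem eikonal_explicit_solution :
    Continuous (fun x : ℝ => 4 * (1 - |Real.cos (x / 2)|)) ∧
    (4 : ℝ) * (1 - |Real.cos ((0 : ℝ) / 2)|) = 0 ∧
    (4 : ℝ) * (1 - |Real.cos ((2 * π) / 2)|) = 0 ∧
    IsViscSubsolutionEikonal (fun x : ℝ => 4 * (1 - |Real.cos (x / 2)|)) ∧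
    IsViscSupersolutionEikonal (fun x : ℝ => 4 * (1 - |Real.cos (x / 2)|)) := by
  exact ⟨by fun_prop, by simp, by simp,
    isViscSubsolutionEikonal_four_mul_one_sub_abs_cos_half,
    isViscSupersolutionEikonal_four_mul_one_sub_abs_cos_half⟩
end

section
/- Let β > 0, σ > 0, and let ℓ : ℝ → ℝ be a 2π-periodic continuously differentiable function. Then there exists a unique 2π-periodic C² function v : ℝ → ℝ satisfying β v(x) − (σ²/2) v''(x) + (1/2)(v'(x))² = ℓ(x) for all x ∈ ℝ. Moreover, if ℓ is even (ℓ(−x) = ℓ(x) for all x), then v is even. -/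
open Real MeasureTheory Filter Topology

/-- A continuous periodic real function attains its maximum. -/
lemma Function.Periodic.exists_forall_le_of_continuous {f : ℝ → ℝ} {T : ℝ}
    (hf : Function.Periodic f T) (hT : 0 < T) (hc : Continuous f) :
    ∃ x₀, ∀ x, f x ≤ f x₀ := by
  obtain ⟨x₀, -, h⟩ := isCompact_Icc.exists_isMaxOn (Set.nonempty_Icc.2 hT.le) hc.continuousOn
  refine ⟨x₀, fun x => ?_⟩
  obtain ⟨y, hy, hxy⟩ := hf.exists_mem_Ico₀ hT x
  rw [hxy]
  exact h (Set.Ico_subset_Icc_self hy)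

/-- The second derivative is nonpositive at a global maximum. -/
lemma second_deriv_nonpos_of_forall_le {w p : ℝ → ℝ} {a x₀ : ℝ}
    (hw : ∀ x, HasDerivAt w (p x) x) (hp : HasDerivAt p a x₀) (hmax : ∀ x, w x ≤ w x₀) :
    a ≤ 0 := by
  by_contra! ha
  have hdw : deriv w = p := funext fun x => (hw x).deriv
  have hp0 : p x₀ = 0 :=
    IsLocalMax.hasDerivAt_eq_zero (Filter.Eventually.of_forall hmax) (hw x₀)
  have hmin : IsLocalMin w x₀ := by
    apply isLocalMin_of_deriv_deriv_pos
    · rw [hdw, hp.deriv]; exact ha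
    · rw [hdw, hp0]
    · exact (hw x₀).continuousAt
  have hconst : w =ᶠ[𝓝 x₀] fun _ => w x₀ :=
    hmin.mono fun x hx => le_antisymm (hmax x) hx
  have hpz : p =ᶠ[𝓝 x₀] fun _ => (0 : ℝ) := by
    have := hconst.deriv
    rw [hdw] at this
    simpa using this
  have := hpz.deriv_eq
  rw [hp.deriv, deriv_const] at this
  exact ha.ne' this

/-- Comparison principle for periodic solutions of `κ v - c v'' + H(v') = f`. -/
lemma periodic_comparison {T κ c δ : ℝ} (hT : 0 < T) (hκ : 0 < κ) (hc : 0 ≤ c) (H : ℝ → ℝ)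
    {v₁ p₁ a₁ f₁ v₂ p₂ a₂ f₂ : ℝ → ℝ}
    (hv₁ : Function.Periodic v₁ T) (hv₂ : Function.Periodic v₂ T)
    (hp₁ : ∀ x, HasDerivAt v₁ (p₁ x) x) (hp₂ : ∀ x, HasDerivAt v₂ (p₂ x) x)
    (ha₁ : ∀ x, HasDerivAt p₁ (a₁ x) x) (ha₂ : ∀ x, HasDerivAt p₂ (a₂ x) x)
    (he₁ : ∀ x, κ * v₁ x - c * a₁ x + H (p₁ x) = f₁ x)
    (he₂ : ∀ x, κ * v₂ x - c * a₂ x + H (p₂ x) = f₂ x)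
    (hf : ∀ x, f₁ x - f₂ x ≤ δ) (x : ℝ) : v₁ x - v₂ x ≤ δ / κ := by
  have hw : ∀ x, HasDerivAt (v₁ - v₂) ((p₁ - p₂) x) x := fun x => (hp₁ x).sub (hp₂ x)
  obtain ⟨x₀, hx₀⟩ := (hv₁.sub hv₂).exists_forall_le_of_continuous hT
    (continuous_iff_continuousAt.2 fun x => (hw x).continuousAt)
  have h0 : (p₁ - p₂) x₀ = 0 :=
    IsLocalMax.hasDerivAt_eq_zero (Filter.Eventually.of_forall hx₀) (hw x₀)
  have h2 : a₁ x₀ - a₂ x₀ ≤ 0 :=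
    second_deriv_nonpos_of_forall_le hw ((ha₁ x₀).sub (ha₂ x₀)) hx₀
  have hpe : p₁ x₀ = p₂ x₀ := sub_eq_zero.1 h0
  have e1 := he₁ x₀
  have e2 := he₂ x₀
  rw [hpe] at e1
  have hm := hx₀ x
  simp only [Pi.sub_apply] at hm
  refine hm.trans ?_
  rw [le_div_iff₀ hκ]
  have := mul_nonneg hc (neg_nonneg.2 h2)
  linarith [hf x₀]

/-- Two-sided form of `periodic_comparison`. -/
lemma periodic_comparison_abs {T κ c δ : ℝ} (hT : 0 < T) (hκ : 0 < κ) (hc : 0 ≤ c) (H : ℝ → ℝ)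
    {v₁ p₁ a₁ f₁ v₂ p₂ a₂ f₂ : ℝ → ℝ}
    (hv₁ : Function.Periodic v₁ T) (hv₂ : Function.Periodic v₂ T)
    (hp₁ : ∀ x, HasDerivAt v₁ (p₁ x) x) (hp₂ : ∀ x, HasDerivAt v₂ (p₂ x) x)
    (ha₁ : ∀ x, HasDerivAt p₁ (a₁ x) x) (ha₂ : ∀ x, HasDerivAt p₂ (a₂ x) x)
    (he₁ : ∀ x, κ * v₁ x - c * a₁ x + H (p₁ x) = f₁ x)
    (he₂ : ∀ x, κ * v₂ x - c * a₂ x + H (p₂ x) = f₂ x)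
    (hf : ∀ x, |f₁ x - f₂ x| ≤ δ) (x : ℝ) : |v₁ x - v₂ x| ≤ δ / κ := by
  rw [abs_sub_le_iff]
  exact ⟨periodic_comparison hT hκ hc H hv₁ hv₂ hp₁ hp₂ ha₁ ha₂ he₁ he₂
      (fun x => (abs_sub_le_iff.1 (hf x)).1) x,
    periodic_comparison hT hκ hc H hv₂ hv₁ hp₂ hp₁ ha₂ ha₁ he₂ he₁
      (fun x => (abs_sub_le_iff.1 (hf x)).2) x⟩

/-- Banach's fixed point theorem on continuous periodic functions with the supremum norm. -/
lemma exists_periodic_fixedPoint {T q : ℝ} (hT : 0 < T) (hq₀ : 0 ≤ q) (hq₁ : q < 1)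
    (Φ : (ℝ → ℝ) → ℝ → ℝ)
    (hΦc : ∀ f, Continuous f → Function.Periodic f T → Continuous (Φ f))
    (hΦp : ∀ f, Continuous f → Function.Periodic f T → Function.Periodic (Φ f) T)
    (hΦ : ∀ f g, Continuous f → Function.Periodic f T → Continuous g → Function.Periodic g T →
      ∀ δ, (∀ x, |f x - g x| ≤ δ) → ∀ x, |Φ f x - Φ g x| ≤ q * δ) :
    ∃ f, Continuous f ∧ Function.Periodic f T ∧ Φ f = f := by
  have : Fact (0 < T) := ⟨hT⟩
  let pull : C(AddCircle T, ℝ) → ℝ → ℝ := fun f x => f (x : AddCircle T)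
  have pull_c : ∀ f, Continuous (pull f) := fun f => f.continuous.comp continuous_quotient_mk'
  have pull_p : ∀ f, Function.Periodic (pull f) T := fun f x => by simp [pull]
  let F : C(AddCircle T, ℝ) → C(AddCircle T, ℝ) := fun f =>
    ⟨(hΦp _ (pull_c f) (pull_p f)).lift, continuous_quot_lift _ (hΦc _ (pull_c f) (pull_p f))⟩
  have hF : ∀ f, pull (F f) = Φ (pull f) := fun f => rfl
  have hcon : ContractingWith ⟨q, hq₀⟩ F := by
    refine ⟨by exact_mod_cast hq₁, LipschitzWith.of_dist_le_mul fun f g => ?_⟩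
    rw [ContinuousMap.dist_le (by positivity)]
    intro y
    obtain ⟨x, rfl⟩ := QuotientAddGroup.mk_surjective y
    exact hΦ _ _ (pull_c f) (pull_p f) (pull_c g) (pull_p g) (dist f g)
      (fun z => ContinuousMap.dist_apply_le_dist (f := f) (g := g) (z : AddCircle T)) x
  refine ⟨pull hcon.fixedPoint, pull_c _, pull_p _, ?_⟩
  rw [← hF, hcon.fixedPoint_isFixedPt.eq]

/-- The equation `y' = m y - g` with periodic continuous `g` has a periodic solution. -/
lemma exists_periodic_linear_ode {T m : ℝ} (hT : 0 < T) (hm : m ≠ 0) {g : ℝ → ℝ}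
    (hgc : Continuous g) (hgp : Function.Periodic g T) :
    ∃ y : ℝ → ℝ, Function.Periodic y T ∧ ∀ x, HasDerivAt y (m * y x - g x) x := by
  have hD : 1 - exp (-(m * T)) ≠ 0 := by
    rw [sub_ne_zero, ne_comm, Ne, Real.exp_eq_one_iff]
    simp [hm, hT.ne']
  set D := 1 - exp (-(m * T)) with hDdef
  have hk : Continuous fun s => exp (-(m * s)) * g s := by fun_prop
  let P : ℝ → ℝ := fun x => ∫ s in (0 : ℝ)..x, exp (-(m * s)) * g s
  have hP : ∀ x, HasDerivAt P (exp (-(m * x)) * g x) x := fun x =>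
    intervalIntegral.integral_hasDerivAt_right (hk.intervalIntegrable _ _)
      (hk.stronglyMeasurableAtFilter _ _) hk.continuousAt
  let Q : ℝ → ℝ := fun x => P (x + T) - P x
  have hQ : ∀ x, HasDerivAt Q (-D * (exp (-(m * x)) * g x)) x := fun x => by
    have h := ((hP (x + T)).comp_add_const x T).sub (hP x)
    refine h.congr_deriv ?_
    rw [hgp x, mul_add, neg_add, exp_add, hDdef]
    ring
  have hQT : ∀ x, Q (x + T) = exp (-(m * T)) * Q x := by
    intro x
    have hQi : ∀ x, Q x = ∫ s in x..x + T, exp (-(m * s)) * g s := fun x =>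
      intervalIntegral.integral_interval_sub_left (hk.intervalIntegrable _ _)
        (hk.intervalIntegrable _ _)
    rw [hQi, hQi, ← intervalIntegral.integral_comp_add_right (fun s => exp (-(m * s)) * g s),
      ← intervalIntegral.integral_const_mul]
    refine intervalIntegral.integral_congr fun s _ => ?_
    simp only [hgp s, mul_add, neg_add, exp_add]
    ring
  refine ⟨fun x => exp (m * x) * Q x / D, fun x => ?_, fun x => ?_⟩
  · simp only [hQT]
    rw [mul_add, exp_add, exp_neg]
    field_simp
  · have h1 : HasDerivAt (fun x => exp (m * x)) (exp (m * x) * (m * 1)) x :=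
      ((hasDerivAt_id x).const_mul m).exp
    have h := (h1.mul (hQ x)).div_const D
    refine h.congr_deriv ?_
    rw [exp_neg]
    field_simp
    ring

/-- Periodic solutions of `y' = m y - g` depend on `g` with Lipschitz constant `1 / |m|`. -/
lemma abs_sub_le_of_periodic_linear_ode {T m δ : ℝ} (hT : 0 < T) (hm : m ≠ 0)
    {g₁ g₂ y₁ y₂ : ℝ → ℝ} (hp₁ : Function.Periodic y₁ T) (hp₂ : Function.Periodic y₂ T)
    (hd₁ : ∀ x, HasDerivAt y₁ (m * y₁ x - g₁ x) x) (hd₂ : ∀ x, HasDerivAt y₂ (m * y₂ x - g₂ x) x)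
    (hg : ∀ x, |g₁ x - g₂ x| ≤ δ) (x : ℝ) : |y₁ x - y₂ x| ≤ δ / |m| := by
  have key : ∀ {g₁ g₂ y₁ y₂ : ℝ → ℝ}, Function.Periodic y₁ T → Function.Periodic y₂ T →
      (∀ x, HasDerivAt y₁ (m * y₁ x - g₁ x) x) → (∀ x, HasDerivAt y₂ (m * y₂ x - g₂ x) x) →
      (∀ x, |g₁ x - g₂ x| ≤ δ) → ∀ x, y₁ x - y₂ x ≤ δ / |m| := by
    intro g₁ g₂ y₁ y₂ hp₁ hp₂ hd₁ hd₂ hg x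
    have hw : ∀ x, HasDerivAt (y₁ - y₂) _ x := fun x => (hd₁ x).sub (hd₂ x)
    obtain ⟨x₀, hx₀⟩ := (hp₁.sub hp₂).exists_forall_le_of_continuous hT
      (continuous_iff_continuousAt.2 fun x => (hw x).continuousAt)
    have h0 := IsLocalMax.hasDerivAt_eq_zero (Filter.Eventually.of_forall hx₀) (hw x₀)
    refine (hx₀ x).trans ((le_abs_self _).trans ?_)
    rw [le_div_iff₀ (abs_pos.2 hm), ← abs_mul]
    have : (y₁ - y₂) x₀ * m = g₁ x₀ - g₂ x₀ := by
      rw [Pi.sub_apply]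
      linarith
    rw [this]
    exact hg x₀
  refine abs_sub_le_iff.2 ⟨key hp₁ hp₂ hd₁ hd₂ hg x, key hp₂ hp₁ hd₂ hd₁ (fun x => ?_) x⟩
  rw [abs_sub_comm]
  exact hg x

/-- Solvability of `κ v - c v'' + H(v') = f` when `κ` is large compared with the Lipschitz
constant of `H`. -/
lemma exists_periodic_solution_of_large {T κ c R : ℝ} (hT : 0 < T) (hc : 0 < c) (hR : 0 ≤ R)
    (hκ : R ^ 2 < κ * c) {H : ℝ → ℝ} (hH : ∀ p q, |H p - H q| ≤ R * |p - q|)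
    (hHc : Continuous H) {f : ℝ → ℝ} (hfc : Continuous f) (hfp : Function.Periodic f T) :
    ∃ v p a : ℝ → ℝ, Function.Periodic v T ∧ (∀ x, HasDerivAt v (p x) x) ∧
      (∀ x, HasDerivAt p (a x) x) ∧ ∀ x, κ * v x - c * a x + H (p x) = f x := by
  have hκ0 : 0 < κ := pos_of_mul_pos_left ((sq_nonneg R).trans_lt hκ) hc.le
  obtain ⟨m, hm, hmκ⟩ : ∃ m : ℝ, 0 < m ∧ c * m ^ 2 = κ := by
    refine ⟨√(κ / c), by positivity, ?_⟩
    rw [Real.sq_sqrt (by positivity)]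
    field_simp
  have hRm : R < c * m := by
    refine lt_of_pow_lt_pow_left₀ 2 (by positivity) (hκ.trans_eq ?_)
    rw [← hmκ]
    ring
  have hplus : ∀ g : ℝ → ℝ, ∃ y : ℝ → ℝ, Continuous g → Function.Periodic g T →
      Function.Periodic y T ∧ ∀ x, HasDerivAt y (m * y x - g x) x := fun g => by
    by_cases h : Continuous g ∧ Function.Periodic g T
    · obtain ⟨y, hy⟩ := exists_periodic_linear_ode hT hm.ne' h.1 h.2
      exact ⟨y, fun _ _ => hy⟩
    · exact ⟨0, fun h₁ h₂ => absurd ⟨h₁, h₂⟩ h⟩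
  have hminus : ∀ g : ℝ → ℝ, ∃ y : ℝ → ℝ, Continuous g → Function.Periodic g T →
      Function.Periodic y T ∧ ∀ x, HasDerivAt y (-m * y x - (-g x)) x := fun g => by
    by_cases h : Continuous g ∧ Function.Periodic g T
    · obtain ⟨y, hy⟩ := exists_periodic_linear_ode hT (neg_ne_zero.2 hm.ne') h.1.neg
        (g := fun x => -g x) (fun x => by simp only [h.2 x])
      exact ⟨y, fun _ _ => hy⟩
    · exact ⟨0, fun h₁ h₂ => absurd ⟨h₁, h₂⟩ h⟩
  choose Y hY using hplus
  choose Z hZ using hminus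
  let G : (ℝ → ℝ) → ℝ → ℝ := fun g x => (Y g x - Z g x) / (2 * c)
  have hG : ∀ g, Continuous g → Function.Periodic g T →
      ∀ x, HasDerivAt (G g) (m * (Y g x + Z g x) / (2 * c) - g x / c) x := fun g h₁ h₂ x => by
    refine ((((hY g h₁ h₂).2 x).sub ((hZ g h₁ h₂).2 x)).div_const (2 * c)).congr_deriv ?_
    field_simp
    ring
  obtain ⟨g, hgc, hgp, hg⟩ := exists_periodic_fixedPoint (q := R / (c * m)) hT (by positivity)
    ((div_lt_one (by positivity)).2 hRm) (fun g x => f x - H (G g x))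
    (fun g h₁ h₂ => hfc.sub (hHc.comp
      (continuous_iff_continuousAt.2 fun x => (hG g h₁ h₂ x).continuousAt)))
    (fun g h₁ h₂ x => by
      simp only [G, hfp x, (hY g h₁ h₂).1 x, (hZ g h₁ h₂).1 x])
    (fun g₁ g₂ h₁ h₁' h₂ h₂' δ hδ x => by
      have e1 := abs_sub_le_of_periodic_linear_ode hT hm.ne' (hY g₁ h₁ h₁').1 (hY g₂ h₂ h₂').1
        (hY g₁ h₁ h₁').2 (hY g₂ h₂ h₂').2 hδ x
      have e2 := abs_sub_le_of_periodic_linear_ode (δ := δ) hT (neg_ne_zero.2 hm.ne')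
        (hZ g₁ h₁ h₁').1 (hZ g₂ h₂ h₂').1 (hZ g₁ h₁ h₁').2 (hZ g₂ h₂ h₂').2
        (fun x => by
          rw [neg_sub_neg, abs_sub_comm]
          exact hδ x) x
      rw [abs_neg] at e2
      rw [abs_of_pos hm] at e1 e2
      have e3 : |G g₂ x - G g₁ x| ≤ δ / (c * m) := by
        have : G g₂ x - G g₁ x = ((Z g₁ x - Z g₂ x) - (Y g₁ x - Y g₂ x)) / (2 * c) := by
          simp only [G]
          ring
        rw [this, abs_div, abs_of_pos (by positivity : 0 < 2 * c), div_le_iff₀ (by positivity)]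
        calc _ ≤ δ / m + δ / m := (abs_sub _ _).trans (add_le_add e2 e1)
          _ = _ := by
            field_simp
            ring
      calc |f x - H (G g₁ x) - (f x - H (G g₂ x))| = |H (G g₂ x) - H (G g₁ x)| := by
            congr 1
            ring
        _ ≤ R * |G g₂ x - G g₁ x| := hH _ _
        _ ≤ R * (δ / (c * m)) := mul_le_mul_of_nonneg_left e3 hR
        _ = _ := by ring)
  refine ⟨fun x => (Y g x + Z g x) / (2 * c * m), G g, _, fun x => ?_, fun x => ?_,
    hG g hgc hgp, fun x => ?_⟩
  · simp only [(hY g hgc hgp).1 x, (hZ g hgc hgp).1 x]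
  · refine ((((hY g hgc hgp).2 x).add ((hZ g hgc hgp).2 x)).div_const (2 * c * m)).congr_deriv ?_
    simp only [G]
    field_simp
    ring
  · have : f x - H (G g x) = g x := congrFun hg x
    rw [← hmκ, sub_eq_iff_eq_add.1 this]
    field_simp
    ring

/-- Solvability of `β v - c v'' + H(v') = f` for Lipschitz `H` and every `β > 0`. -/
lemma exists_periodic_solution_of_lipschitz {T β c R : ℝ} (hT : 0 < T) (hβ : 0 < β) (hc : 0 < c)
    (hR : 0 ≤ R) {H : ℝ → ℝ} (hH : ∀ p q, |H p - H q| ≤ R * |p - q|)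
    (hHc : Continuous H) {f : ℝ → ℝ} (hfc : Continuous f) (hfp : Function.Periodic f T) :
    ∃ v p a : ℝ → ℝ, Function.Periodic v T ∧ (∀ x, HasDerivAt v (p x) x) ∧
      (∀ x, HasDerivAt p (a x) x) ∧ ∀ x, β * v x - c * a x + H (p x) = f x := by
  set K := (R ^ 2 + 1) / c with hK
  have hK0 : 0 < K := by positivity
  have hκ : R ^ 2 < (β + K) * c := by
    rw [hK, add_mul, div_mul_cancel₀ _ hc.ne']
    nlinarith
  have hex : ∀ g : ℝ → ℝ, ∃ v p a : ℝ → ℝ, Continuous g → Function.Periodic g T →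
      Function.Periodic v T ∧ (∀ x, HasDerivAt v (p x) x) ∧ (∀ x, HasDerivAt p (a x) x) ∧
      ∀ x, (β + K) * v x - c * a x + H (p x) = f x + K * g x := fun g => by
    by_cases h : Continuous g ∧ Function.Periodic g T
    · obtain ⟨v, p, a, hv⟩ := exists_periodic_solution_of_large hT hc hR hκ hH hHc
        (f := fun x => f x + K * g x) (hfc.add (h.1.const_mul K))
        (fun x => by simp only [hfp x, h.2 x])
      exact ⟨v, p, a, fun _ _ => hv⟩
    · exact ⟨0, 0, 0, fun h₁ h₂ => absurd ⟨h₁, h₂⟩ h⟩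
  choose V P A hV using hex
  obtain ⟨u, huc, hup, hu⟩ := exists_periodic_fixedPoint (q := K / (β + K)) hT (by positivity)
    ((div_lt_one (by positivity)).2 (by linarith)) V
    (fun g h₁ h₂ => continuous_iff_continuousAt.2 fun x => ((hV g h₁ h₂).2.1 x).continuousAt)
    (fun g h₁ h₂ => (hV g h₁ h₂).1)
    (fun g₁ g₂ h₁ h₁' h₂ h₂' δ hδ x => by
      obtain ⟨b₁, b₂, b₃, b₄⟩ := hV g₁ h₁ h₁'
      obtain ⟨d₁, d₂, d₃, d₄⟩ := hV g₂ h₂ h₂'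
      have := periodic_comparison_abs (δ := K * δ) hT (by positivity : 0 < β + K) hc.le H
        b₁ d₁ b₂ d₂ b₃ d₃ b₄ d₄ (fun x => by
          rw [add_sub_add_left_eq_sub, ← mul_sub, abs_mul, abs_of_pos hK0]
          exact mul_le_mul_of_nonneg_left (hδ x) hK0.le) x
      rwa [div_mul_eq_mul_div])
  obtain ⟨h₁, h₂, h₃, h₄⟩ := hV u huc hup
  rw [hu] at h₁ h₂ h₄
  exact ⟨u, P u, A u, h₁, h₂, h₃, fun x => by linarith [h₄ x]⟩

/-- A periodic `C¹` function is Lipschitz. -/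
lemma Function.Periodic.exists_abs_sub_le {f : ℝ → ℝ} {T : ℝ} (hf : Function.Periodic f T)
    (hT : 0 < T) (hc : ContDiff ℝ 1 f) : ∃ L, 0 ≤ L ∧ ∀ x y, |f x - f y| ≤ L * |x - y| := by
  have hd : Function.Periodic (fun x => |deriv f x|) T := fun x => by
    have : (fun y => f (y + T)) = f := funext hf
    simp only
    rw [← deriv_comp_add_const, this]
  obtain ⟨x₀, h⟩ := hd.exists_forall_le_of_continuous hT (hc.continuous_deriv le_rfl).abs
  exact ⟨|deriv f x₀|, abs_nonneg _, fun x y =>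
    convex_univ.norm_image_sub_le_of_norm_deriv_le
      (fun x _ => (hc.differentiable one_ne_zero) x) (fun x _ => h x) (Set.mem_univ y)
      (Set.mem_univ x)⟩

/-- Half the square of the truncation to `[-R, R]` is Lipschitz with constant `R`. -/
lemma abs_half_sq_clamp_sub_le {R : ℝ} (hR : 0 ≤ R) (p q : ℝ) :
    |1 / 2 * (max (-R) (min p R)) ^ 2 - 1 / 2 * (max (-R) (min q R)) ^ 2| ≤ R * |p - q| := by
  have hb : ∀ p, |max (-R) (min p R)| ≤ R := fun p =>
    abs_le.2 ⟨le_max_left _ _, max_le (by linarith) (min_le_right _ _)⟩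
  have hd : |max (-R) (min p R) - max (-R) (min q R)| ≤ |p - q| := by
    rw [max_comm (-R), max_comm (-R)]
    refine (abs_max_sub_max_le_abs _ _ _).trans ((abs_min_sub_min_le_max _ _ _ _).trans ?_)
    simp
  set r := max (-R) (min p R) with hr
  set s := max (-R) (min q R) with hs
  calc |1 / 2 * r ^ 2 - 1 / 2 * s ^ 2| = 1 / 2 * |r + s| * |r - s| := by
        rw [mul_assoc, ← abs_mul, ← abs_of_pos (by norm_num : (0 : ℝ) < 1 / 2), ← abs_mul,
          abs_of_pos (by norm_num : (0 : ℝ) < 1 / 2)]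
        congr 1
        ring
    _ ≤ R * |p - q| := by
        refine mul_le_mul ?_ hd (abs_nonneg _) hR
        linarith [abs_add_le r s, hb p, hb q]

/-- Existence of a periodic solution of `β v - c v'' + (v')² / 2 = ℓ`. -/
lemma exists_periodic_hjb_solution {T β c : ℝ} (hT : 0 < T) (hβ : 0 < β) (hc : 0 < c)
    {ℓ : ℝ → ℝ} (hℓp : Function.Periodic ℓ T) (hℓ : ContDiff ℝ 1 ℓ) :
    ∃ v p a : ℝ → ℝ, Function.Periodic v T ∧ (∀ x, HasDerivAt v (p x) x) ∧
      (∀ x, HasDerivAt p (a x) x) ∧ ∀ x, β * v x - c * a x + 1 / 2 * (p x) ^ 2 = ℓ x := by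
  obtain ⟨L, hL, hLip⟩ := hℓp.exists_abs_sub_le hT hℓ
  have hR : 0 ≤ L / β := by positivity
  set R := L / β with hRdef
  obtain ⟨v, p, a, hv, hp, ha, he⟩ := exists_periodic_solution_of_lipschitz hT hβ hc hR
    (abs_half_sq_clamp_sub_le hR) (by fun_prop) hℓ.continuous hℓp
  have hvLip : ∀ h x, |v (x + h) - v x| ≤ R * |h| := fun h x => by
    have := periodic_comparison_abs (δ := L * |h|) hT hβ hc.le
      (fun p => 1 / 2 * (max (-R) (min p R)) ^ 2)
      (v₁ := fun x => v (x + h)) (p₁ := fun x => p (x + h)) (a₁ := fun x => a (x + h))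
      (f₁ := fun x => ℓ (x + h)) (fun x => by simp only [add_right_comm x T h, hv (x + h)]) hv
      (fun x => (hp (x + h)).comp_add_const x h) hp
      (fun x => (ha (x + h)).comp_add_const x h) ha (fun x => he (x + h)) he
      (fun x => by simpa using hLip (x + h) x) x
    rwa [hRdef, div_mul_eq_mul_div]
  have hpR : ∀ x, |p x| ≤ R := fun x => by
    refine (hp x).le_of_lip' hR (Filter.Eventually.of_forall fun y => ?_)
    simpa using hvLip (y - x) x
  refine ⟨v, p, a, hv, hp, ha, fun x => ?_⟩
  obtain ⟨h₁, h₂⟩ := abs_le.1 (hpR x)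
  have := he x
  rwa [min_eq_left h₂, max_eq_right h₁] at this

/-- For `β, σ > 0` and `ℓ` a `2π`-periodic `C¹` function, there exists a
unique `2π`-periodic `C²` solution `v` of
`β v − (σ²/2) v'' + (1/2)(v')² = ℓ`; moreover `v` is even whenever `ℓ` is even. -/
theorem hjb_existence_uniqueness_even
    (β σ : ℝ) (hβ : 0 < β) (hσ : 0 < σ)
    (ℓ : ℝ → ℝ)
    (hℓper : Function.Periodic ℓ (2 * π))
    (hℓC1 : ContDiff ℝ 1 ℓ) :
    ∃ v : ℝ → ℝ,
      (Function.Periodic v (2 * π) ∧ ContDiff ℝ 2 v ∧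
        ∀ x : ℝ, β * v x - σ ^ 2 / 2 * deriv (deriv v) x + (1 / 2) * (deriv v x) ^ 2 = ℓ x) ∧
      (∀ v' : ℝ → ℝ,
        (Function.Periodic v' (2 * π) ∧ ContDiff ℝ 2 v' ∧
          ∀ x : ℝ, β * v' x - σ ^ 2 / 2 * deriv (deriv v') x + (1 / 2) * (deriv v' x) ^ 2 = ℓ x)
        → v' = v) ∧
      ((∀ x : ℝ, ℓ (-x) = ℓ x) → ∀ x : ℝ, v (-x) = v x) := by
  have hT : 0 < 2 * π := by positivity
  have hc : 0 < σ ^ 2 / 2 := by positivity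
  have huniq : ∀ v w : ℝ → ℝ,
      (Function.Periodic v (2 * π) ∧ ContDiff ℝ 2 v ∧
        ∀ x, β * v x - σ ^ 2 / 2 * deriv (deriv v) x + (1 / 2) * (deriv v x) ^ 2 = ℓ x) →
      (Function.Periodic w (2 * π) ∧ ContDiff ℝ 2 w ∧
        ∀ x, β * w x - σ ^ 2 / 2 * deriv (deriv w) x + (1 / 2) * (deriv w x) ^ 2 = ℓ x) →
      v = w := by
    rintro v w ⟨hv, hvc, hve⟩ ⟨hw, hwc, hwe⟩
    have hd : ∀ {u : ℝ → ℝ}, ContDiff ℝ 2 u → (∀ x, HasDerivAt u (deriv u x) x) ∧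
        ∀ x, HasDerivAt (deriv u) (deriv (deriv u) x) x := fun hu =>
      ⟨fun x => (hu.differentiable two_ne_zero x).hasDerivAt,
        fun x => (hu.differentiable_deriv_two x).hasDerivAt⟩
    funext x
    have := periodic_comparison_abs (δ := 0) hT hβ hc.le (fun p => 1 / 2 * p ^ 2) hv hw
      (hd hvc).1 (hd hwc).1 (hd hvc).2 (hd hwc).2 hve hwe (fun x => by simp) x
    rw [zero_div] at this
    exact sub_eq_zero.1 (abs_nonpos_iff.1 this)
  obtain ⟨v, p, a, hv, hp, ha, he⟩ := exists_periodic_hjb_solution hT hβ hc hℓper hℓC1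
  have hdv : deriv v = p := funext fun x => (hp x).deriv
  have hdp : deriv p = a := funext fun x => (ha x).deriv
  have hvc : ContDiff ℝ 2 v := by
    have hpc : Continuous p := continuous_iff_continuousAt.2 fun x => (ha x).continuousAt
    have hac : Continuous a := by
      have : a = fun x => (β * v x + 1 / 2 * (p x) ^ 2 - ℓ x) / (σ ^ 2 / 2) := by
        funext x
        rw [eq_div_iff hc.ne']
        linarith [he x]
      rw [this]
      have hvc : Continuous v := continuous_iff_continuousAt.2 fun x => (hp x).continuousAt
      have := hℓC1.continuous
      fun_prop
    rw [show (2 : WithTop ℕ∞) = 1 + 1 by norm_num, contDiff_succ_iff_deriv]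
    refine ⟨fun x => (hp x).differentiableAt, by simp, ?_⟩
    rw [hdv, contDiff_one_iff_deriv, hdp]
    exact ⟨fun x => (ha x).differentiableAt, hac⟩
  have hsol : Function.Periodic v (2 * π) ∧ ContDiff ℝ 2 v ∧
      ∀ x, β * v x - σ ^ 2 / 2 * deriv (deriv v) x + (1 / 2) * (deriv v x) ^ 2 = ℓ x :=
    ⟨hv, hvc, fun x => by rw [hdv, hdp]; exact he x⟩
  refine ⟨v, hsol, fun w hw => huniq w v hw hsol, fun heven x => ?_⟩
  refine congrFun (huniq (fun x => v (-x)) v ⟨fun x => ?_, hvc.comp contDiff_neg, fun x => ?_⟩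
    hsol) x
  · change v (-(x + 2 * π)) = v (-x)
    rw [neg_add, ← sub_eq_add_neg]
    exact hv.sub_eq (-x)
  · have h1 : deriv (fun x => v (-x)) = fun x => -deriv v (-x) := funext fun x => deriv_comp_neg v x
    have h2 : deriv (fun x => -deriv v (-x)) x = deriv (deriv v) (-x) := by
      rw [deriv.fun_neg, deriv_comp_neg, neg_neg]
    rw [h1, h2, ← heven x, ← hsol.2.2 (-x)]
    ring
end

section
/- Let β > 0 and σ > 0, and set A(γ) := ∫_{−π}^{π} cos(x) μ^γ(dx) for γ ≥ 0. Then A(0) = 0 and A has right derivative 1/κ_c at the origin: lim_{γ → 0⁺} A(γ)/γ = 2/(σ²(2β + σ²)) = 1/κ_c. -/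
open Real MeasureTheory Filter Topology

/-- At a global maximum of a twice differentiable function the second derivative is nonpositive. -/
theorem deriv_deriv_nonpos_of_forall_le {f : ℝ → ℝ} {x₀ : ℝ} (hf : Continuous f)
    (hmax : ∀ x, f x ≤ f x₀) : deriv (deriv f) x₀ ≤ 0 := by
  by_contra! hpos
  have hlmax : IsLocalMax f x₀ := Eventually.of_forall hmax
  have hlmin : IsLocalMin f x₀ :=
    isLocalMin_of_deriv_deriv_pos hpos hlmax.deriv_eq_zero hf.continuousAt
  have hconst : f =ᶠ[𝓝 x₀] fun _ => f x₀ := by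
    filter_upwards [hlmin] with x hx using le_antisymm (hmax x) hx
  have hzero : deriv (deriv f) x₀ = 0 := by
    rw [hconst.deriv.deriv_eq]
    simp
  exact hpos.ne' hzero

/-- A continuous periodic function attains its maximum, and the derivative tests hold there. -/
theorem Function.Periodic.exists_max_deriv {f : ℝ → ℝ} {T : ℝ} (hT : 0 < T)
    (hper : Function.Periodic f T) (hf : Continuous f) :
    ∃ x₀, (∀ x, f x ≤ f x₀) ∧ deriv f x₀ = 0 ∧ deriv (deriv f) x₀ ≤ 0 := by
  obtain ⟨x₀, -, hx₀⟩ := isCompact_Icc.exists_isMaxOn (Set.nonempty_Icc.2 hT.le) hf.continuousOn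
  have hmax : ∀ x, f x ≤ f x₀ := by
    intro x
    obtain ⟨y, hy, hxy⟩ := hper.exists_mem_Ico₀ hT x
    rw [hxy]
    exact hx₀ (Set.Ico_subset_Icc_self hy)
  have hl : IsLocalMax f x₀ := Eventually.of_forall hmax
  exact ⟨x₀, hmax, hl.deriv_eq_zero, deriv_deriv_nonpos_of_forall_le hf hmax⟩

/-- A continuous periodic function attains its minimum, and the derivative tests hold there. -/
theorem Function.Periodic.exists_min_deriv {f : ℝ → ℝ} {T : ℝ} (hT : 0 < T)
    (hper : Function.Periodic f T) (hf : Continuous f) :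
    ∃ x₀, (∀ x, f x₀ ≤ f x) ∧ deriv f x₀ = 0 ∧ 0 ≤ deriv (deriv f) x₀ := by
  have hper' : Function.Periodic (-f) T := fun x => by simp [hper x]
  obtain ⟨x₀, h1, h2, h3⟩ := hper'.exists_max_deriv hT hf.neg
  refine ⟨x₀, fun x => by simpa using h1 x, ?_, ?_⟩
  · simpa using h2
  · simpa using h3

/-- Comparison of the solution of the discounted Hamilton–Jacobi–Bellman equation with the
solution `-(γ / (β + σ ^ 2 / 2)) cos` of its linearization. -/
theorem hjb_linearization_bounds {β σ γ : ℝ} (hβ : 0 < β) {v : ℝ → ℝ}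
    (hper : Function.Periodic v (2 * π)) (hC2 : ContDiff ℝ 2 v)
    (hODE : ∀ x : ℝ, β * v x - σ ^ 2 / 2 * deriv (deriv v) x + (1 / 2) * (deriv v x) ^ 2
      = -γ * Real.cos x) (x : ℝ) :
    -(γ ^ 2 / (2 * β * (β + σ ^ 2 / 2) ^ 2)) ≤ v x + γ / (β + σ ^ 2 / 2) * Real.cos x ∧
      v x + γ / (β + σ ^ 2 / 2) * Real.cos x ≤ 0 := by
  have hc : 0 < β + σ ^ 2 / 2 := by positivity
  set k : ℝ := γ / (β + σ ^ 2 / 2) with hk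
  have hγ : γ = k * (β + σ ^ 2 / 2) := by rw [hk]; field_simp
  set D : ℝ → ℝ := fun x => v x + k * Real.cos x with hD
  have hv1 : Differentiable ℝ v := hC2.differentiable (by norm_num)
  have hv2 : Differentiable ℝ (deriv v) := by
    have : ContDiff ℝ (1 + 1) v := by simpa [one_add_one_eq_two] using hC2
    exact (contDiff_succ_iff_deriv.1 this).2.2.differentiable (by norm_num)
  have hD1 : deriv D = fun x => deriv v x + k * -Real.sin x := by
    funext y
    exact ((hv1 y).hasDerivAt.add ((Real.hasDerivAt_cos y).const_mul k)).deriv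
  have hD2 : ∀ y, deriv (deriv D) y = deriv (deriv v) y + k * -Real.cos y := by
    intro y
    rw [hD1]
    exact ((hv2 y).hasDerivAt.add ((Real.hasDerivAt_sin y).neg.const_mul k)).deriv
  have hDper : Function.Periodic D (2 * π) := fun y => by
    simp only [hD, hper y, Real.cos_add_two_pi]
  have hDcont : Continuous D := hv1.continuous.add (continuous_const.mul Real.continuous_cos)
  have hDeq : ∀ y, β * D y - σ ^ 2 / 2 * deriv (deriv D) y + (1 / 2) * (deriv v y) ^ 2 = 0 := by
    intro y
    rw [hD2]
    have := hODE y
    rw [hγ] at this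
    simp only [hD]
    linear_combination this
  constructor
  · obtain ⟨y, hmin, h1, h2⟩ := hDper.exists_min_deriv two_pi_pos hDcont
    refine le_trans ?_ (hmin x)
    have hvy : deriv v y = k * Real.sin y := by
      rw [hD1] at h1
      linear_combination h1
    have hsq : (deriv v y) ^ 2 ≤ k ^ 2 := by
      rw [hvy, mul_pow]
      exact mul_le_of_le_one_right (sq_nonneg k) (Real.sin_sq_le_one y)
    have hE : γ ^ 2 / (2 * β * (β + σ ^ 2 / 2) ^ 2) = k ^ 2 / (2 * β) := by
      rw [hk]; field_simp
    have hnn : 0 ≤ σ ^ 2 / 2 * deriv (deriv D) y := by positivity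
    rw [hE, neg_le, le_div_iff₀ (by positivity)]
    linarith [hDeq y]
  · obtain ⟨y, hmax, -, h2⟩ := hDper.exists_max_deriv two_pi_pos hDcont
    refine (hmax x).trans ?_
    have hnn : σ ^ 2 / 2 * deriv (deriv D) y ≤ 0 :=
      mul_nonpos_of_nonneg_of_nonpos (by positivity) h2
    have hprod : β * D y ≤ 0 := by linarith [hDeq y, sq_nonneg (deriv v y)]
    exact nonpos_of_mul_nonpos_right hprod hβ

/-- First-order expansion of the Gibbs average of `cos` for potentials that are close to a
multiple of `cos`. -/
theorem tendsto_gibbs_average_cos_div {s : ℝ → ℝ → ℝ} {b M : ℝ} (hM : 0 ≤ M)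
    (hcont : ∀ γ, 0 < γ → Continuous (s γ))
    (hs : ∀ γ, 0 < γ → ∀ x, |s γ x - b * γ * Real.cos x| ≤ M * γ ^ 2) :
    Tendsto (fun γ : ℝ => (∫ x in (-π)..π, Real.cos x * Real.exp (s γ x)) /
      (∫ x in (-π)..π, Real.exp (s γ x)) / γ) (𝓝[>] 0) (𝓝 (b / 2)) := by
  set L : ℝ := |b| + M + 1 with hL
  have hL1 : 1 ≤ L := by rw [hL]; linarith [abs_nonneg b]
  have hL0 : 0 < L := by linarith
  have hid : Tendsto (fun γ : ℝ => γ) (𝓝[>] 0) (𝓝 0) :=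
    tendsto_nhdsWithin_of_tendsto_nhds tendsto_id
  have hsmall : ∀ᶠ γ : ℝ in 𝓝[>] 0, 0 < γ ∧ L * γ ≤ 1 := by
    filter_upwards [Ioo_mem_nhdsGT (inv_pos.2 hL0)] with γ hγ
    refine ⟨hγ.1, ?_⟩
    have := mul_le_mul_of_nonneg_left hγ.2.le hL0.le
    rwa [mul_inv_cancel₀ hL0.ne'] at this
  have hbound : ∀ γ, 0 < γ → L * γ ≤ 1 → ∀ x, |s γ x| ≤ L * γ := by
    intro γ h0 h1 x
    have hγ1 : γ ≤ 1 := by nlinarith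
    have h2 : |b * γ * Real.cos x| ≤ |b| * γ := by
      rw [abs_mul, abs_mul, abs_of_pos h0]
      exact mul_le_of_le_one_right (by positivity) (Real.abs_cos_le_one x)
    have h3 : M * γ ^ 2 ≤ M * γ := mul_le_mul_of_nonneg_left (by nlinarith) hM
    have h4 := abs_add_le (s γ x - b * γ * Real.cos x) (b * γ * Real.cos x)
    rw [sub_add_cancel] at h4
    have h5 := hs γ h0 x
    rw [hL]
    linarith
  have hZ : Tendsto (fun γ : ℝ => ∫ x in (-π)..π, Real.exp (s γ x)) (𝓝[>] 0) (𝓝 (2 * π)) := by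
    rw [tendsto_iff_norm_sub_tendsto_zero]
    have hlim : Tendsto (fun γ : ℝ => 2 * (L * γ) * |π - -π|) (𝓝[>] 0) (𝓝 0) := by
      simpa using ((hid.const_mul L).const_mul 2).mul_const |π - -π|
    refine squeeze_zero' (Eventually.of_forall fun _ => norm_nonneg _) ?_ hlim
    filter_upwards [hsmall] with γ hγ
    have hint : IntervalIntegrable (fun x => Real.exp (s γ x)) volume (-π) π :=
      (Real.continuous_exp.comp (hcont γ hγ.1)).intervalIntegrable _ _
    have heq : (∫ x in (-π)..π, Real.exp (s γ x)) - 2 * π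
        = ∫ x in (-π)..π, (Real.exp (s γ x) - 1) := by
      rw [intervalIntegral.integral_sub hint (by simp), intervalIntegral.integral_const, smul_eq_mul]
      ring
    rw [heq]
    refine intervalIntegral.norm_integral_le_of_norm_le_const fun x _ => ?_
    have hb := hbound γ hγ.1 hγ.2 x
    have := Real.abs_exp_sub_one_le (hb.trans hγ.2)
    rw [Real.norm_eq_abs]
    linarith
  have hN : Tendsto (fun γ : ℝ => (∫ x in (-π)..π, Real.cos x * Real.exp (s γ x)) / γ)
      (𝓝[>] 0) (𝓝 (b * π)) := by
    rw [tendsto_iff_norm_sub_tendsto_zero]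
    have hlim : Tendsto (fun γ : ℝ => (L ^ 2 + M) * γ * |π - -π|) (𝓝[>] 0) (𝓝 0) := by
      simpa using (hid.const_mul (L ^ 2 + M)).mul_const |π - -π|
    refine squeeze_zero' (Eventually.of_forall fun _ => norm_nonneg _) ?_ hlim
    filter_upwards [hsmall] with γ hγ
    have hint : IntervalIntegrable (fun x => Real.cos x * Real.exp (s γ x)) volume (-π) π :=
      (Real.continuous_cos.mul (Real.continuous_exp.comp (hcont γ hγ.1))).intervalIntegrable _ _
    have hint1 : IntervalIntegrable (fun x => Real.cos x) volume (-π) π :=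
      Real.continuous_cos.intervalIntegrable _ _
    have hint2 : IntervalIntegrable (fun x => b * γ * Real.cos x ^ 2) volume (-π) π :=
      (continuous_const.mul (Real.continuous_cos.pow 2)).intervalIntegrable _ _
    have heq : (∫ x in (-π)..π, Real.cos x * Real.exp (s γ x)) - b * γ * π
        = ∫ x in (-π)..π, (Real.cos x * Real.exp (s γ x) - Real.cos x - b * γ * Real.cos x ^ 2) := by
      rw [intervalIntegral.integral_sub (hint.sub hint1) hint2,
        intervalIntegral.integral_sub hint hint1, intervalIntegral.integral_const_mul,
        integral_cos, integral_cos_sq]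
      simp
    have hest : ‖(∫ x in (-π)..π, Real.cos x * Real.exp (s γ x)) - b * γ * π‖
        ≤ (L ^ 2 + M) * γ ^ 2 * |π - -π| := by
      rw [heq]
      refine intervalIntegral.norm_integral_le_of_norm_le_const fun x _ => ?_
      have hb := hbound γ hγ.1 hγ.2 x
      have h1 := Real.abs_exp_sub_one_sub_id_le (hb.trans hγ.2)
      have h2 : s γ x ^ 2 ≤ L ^ 2 * γ ^ 2 := by
        rw [← mul_pow, ← sq_abs]
        exact pow_le_pow_left₀ (abs_nonneg _) hb 2
      have h3 := hs γ hγ.1 x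
      have hsplit : Real.cos x * Real.exp (s γ x) - Real.cos x - b * γ * Real.cos x ^ 2
          = Real.cos x * ((Real.exp (s γ x) - 1 - s γ x) + (s γ x - b * γ * Real.cos x)) := by
        ring
      rw [Real.norm_eq_abs, hsplit, abs_mul]
      have h4 := mul_le_of_le_one_left (abs_nonneg
        ((Real.exp (s γ x) - 1 - s γ x) + (s γ x - b * γ * Real.cos x))) (Real.abs_cos_le_one x)
      have h5 := abs_add_le (Real.exp (s γ x) - 1 - s γ x) (s γ x - b * γ * Real.cos x)
      linarith
    have hγ0 : γ ≠ 0 := hγ.1.ne'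
    have hdiv : (∫ x in (-π)..π, Real.cos x * Real.exp (s γ x)) / γ - b * π
        = ((∫ x in (-π)..π, Real.cos x * Real.exp (s γ x)) - b * γ * π) / γ := by
      field_simp
    rw [hdiv, norm_div, Real.norm_of_nonneg hγ.1.le, div_le_iff₀ hγ.1]
    exact hest.trans_eq (by ring)
  have hlim := hN.div hZ two_pi_pos.ne'
  have hval : b * π / (2 * π) = b / 2 := by field_simp
  rw [hval] at hlim
  refine hlim.congr fun γ => ?_
  simp only [Pi.div_apply]
  rw [div_right_comm]

/-- The map `A(γ) := ∫ cos dμ^γ` vanishes at `0` and has right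
derivative `2/(σ²(2β+σ²)) = 1/κ_c` at the origin. -/
theorem kuramoto_A_derivative_at_zero
    (β σ : ℝ) (hβ : 0 < β) (hσ : 0 < σ)
    (v : ℝ → ℝ → ℝ)
    (hper : ∀ γ, 0 ≤ γ → Function.Periodic (v γ) (2 * π))
    (hC2 : ∀ γ, 0 ≤ γ → ContDiff ℝ 2 (v γ))
    (hODE : ∀ γ, 0 ≤ γ → ∀ x : ℝ,
      β * v γ x - σ ^ 2 / 2 * deriv (deriv (v γ)) x + (1 / 2) * (deriv (v γ) x) ^ 2
        = -γ * Real.cos x)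
    (Z : ℝ → ℝ)
    (hZ : ∀ γ, Z γ = ∫ y in (-π)..π, Real.exp (-(2 / σ ^ 2) * v γ y))
    (A : ℝ → ℝ)
    (hA : ∀ γ, A γ
      = (∫ x in (-π)..π, Real.cos x * Real.exp (-(2 / σ ^ 2) * v γ x)) / Z γ) :
    A 0 = 0 ∧
    Tendsto (fun γ : ℝ => A γ / γ) (𝓝[>] 0) (𝓝 (2 / (σ ^ 2 * (2 * β + σ ^ 2)))) ∧
    2 / (σ ^ 2 * (2 * β + σ ^ 2)) = 1 / (β * σ ^ 2 + σ ^ 4 / 2) := by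
  have hc : 0 < β + σ ^ 2 / 2 := by positivity
  refine ⟨?_, ?_, by field_simp⟩
  · have hv0 : ∀ x, v 0 x = 0 := fun x => by
      have h := hjb_linearization_bounds hβ (hper 0 le_rfl) (hC2 0 le_rfl) (hODE 0 le_rfl) x
      norm_num at h
      exact le_antisymm h.2 h.1
    simp [hA, hv0]
  · have key := tendsto_gibbs_average_cos_div (s := fun γ x => -(2 / σ ^ 2) * v γ x)
      (b := 2 / σ ^ 2 / (β + σ ^ 2 / 2))
      (M := 2 / σ ^ 2 * (1 / (2 * β * (β + σ ^ 2 / 2) ^ 2))) (by positivity)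
      (fun γ hγ => continuous_const.mul (hC2 γ hγ.le).continuous) ?_
    · have hval : 2 / σ ^ 2 / (β + σ ^ 2 / 2) / 2 = 2 / (σ ^ 2 * (2 * β + σ ^ 2)) := by
        field_simp
      rw [hval] at key
      refine key.congr fun γ => ?_
      rw [hA, hZ]
    · intro γ hγ x
      obtain ⟨h1, h2⟩ :=
        hjb_linearization_bounds hβ (hper γ hγ.le) (hC2 γ hγ.le) (hODE γ hγ.le) x
      have heq : -(2 / σ ^ 2) * v γ x - 2 / σ ^ 2 / (β + σ ^ 2 / 2) * γ * Real.cos x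
          = -(2 / σ ^ 2) * (v γ x + γ / (β + σ ^ 2 / 2) * Real.cos x) := by ring
      have ha : 0 < 2 / σ ^ 2 := by positivity
      rw [heq, abs_mul, abs_neg, abs_of_pos ha, abs_of_nonpos h2, mul_assoc]
      refine mul_le_mul_of_nonneg_left ?_ ha.le
      rw [one_div_mul_eq_div]
      linarith
end

section
/- Let β > 0, σ > 0 and γ ≥ 0. Then v^γ(x) ≤ −γ/β + √γ · (x²/2 + σ²/(2β)) for all x ∈ [−π, π]. -/
open Real MeasureTheory Filter Topology

/-- Second order necessary condition at a local maximum. -/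
lemma IsLocalMax.deriv_deriv_nonpos_s9 {f : ℝ → ℝ} {a : ℝ} (h : IsLocalMax f a)
    (hf : ContinuousAt f a) : deriv (deriv f) a ≤ 0 := by
  by_contra! hpos
  have hmin : IsLocalMin f a := isLocalMin_of_deriv_deriv_pos hpos h.deriv_eq_zero hf
  have hconst : f =ᶠ[𝓝 a] fun _ => f a := by
    filter_upwards [h, hmin] with x h₁ h₂ using le_antisymm h₁ h₂
  have hzero : deriv (deriv f) a = 0 := by
    rw [hconst.deriv.deriv_eq]
    simp
  exact hpos.ne' hzero

/-- A periodic function minus an even function that is monotone in `|x|` attains its maximum. -/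
lemma exists_forall_periodic_sub_le {f g : ℝ → ℝ} (hf : Continuous f)
    (hper : Function.Periodic f (2 * π)) (hg : Continuous g)
    (hmono : ∀ x y, |x| ≤ |y| → g x ≤ g y) :
    ∃ a, ∀ x, f x - g x ≤ f a - g a := by
  obtain ⟨a, -, ha⟩ := (isCompact_Icc (a := -π) (b := π)).exists_isMaxOn
    ⟨0, by constructor <;> linarith [pi_pos]⟩ (hf.sub hg).continuousOn
  refine ⟨a, fun x => ?_⟩
  by_cases hx : x ∈ Set.Icc (-π) π
  · exact ha hx
  obtain ⟨y, hy, hxy⟩ := hper.exists_mem_Ico two_pi_pos x (-π)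
  have hy' : y ∈ Set.Icc (-π) π := ⟨hy.1, by linarith [hy.2]⟩
  have habs : |y| ≤ |x| := by
    have h₁ : |y| ≤ π := abs_le.2 hy'
    have h₂ : π < |x| := by
      by_contra! h
      exact hx (abs_le.1 h)
    linarith
  calc f x - g x ≤ f y - g y := by rw [hxy]; linarith [hmono y x habs]
    _ ≤ f a - g a := ha hy'

/-- upper bound. For every `γ ≥ 0` and `x ∈ [−π, π]`,
`v^γ(x) ≤ −γ/β + √γ (x²/2 + σ²/(2β))`. -/
theorem kuramoto_value_upper_bound
    (β σ : ℝ) (hβ : 0 < β) (hσ : 0 < σ)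
    (v : ℝ → ℝ → ℝ)
    (hper : ∀ γ, 0 ≤ γ → Function.Periodic (v γ) (2 * π))
    (hC2 : ∀ γ, 0 ≤ γ → ContDiff ℝ 2 (v γ))
    (hODE : ∀ γ, 0 ≤ γ → ∀ x : ℝ,
      β * v γ x - σ ^ 2 / 2 * deriv (deriv (v γ)) x + (1 / 2) * (deriv (v γ) x) ^ 2
        = -γ * Real.cos x)
    (γ : ℝ) (hγ : 0 ≤ γ) :
    ∀ x ∈ Set.Icc (-π) π,
      v γ x ≤ -(γ / β) + Real.sqrt γ * (x ^ 2 / 2 + σ ^ 2 / (2 * β)) := by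
  have hv := hC2 γ hγ
  have hdv : Differentiable ℝ (v γ) := hv.differentiable (by norm_num)
  have hddv : Differentiable ℝ (deriv (v γ)) :=
    (hv.iterate_deriv' 1 1).differentiable (by norm_num)
  set s := Real.sqrt γ with hs
  have hs0 : 0 ≤ s := Real.sqrt_nonneg γ
  have hs2 : s ^ 2 = γ := Real.sq_sqrt hγ
  set w : ℝ → ℝ := fun x => -(γ / β) + s * (x ^ 2 / 2 + σ ^ 2 / (2 * β)) with hw
  have hw' (x : ℝ) : HasDerivAt w (s * x) x := by
    have h := ((((hasDerivAt_pow 2 x).div_const 2).add_const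
      (σ ^ 2 / (2 * β))).const_mul s).const_add (-(γ / β))
    exact h.congr_deriv (by simp)
  have hcw : Continuous w := by fun_prop
  obtain ⟨a, ha⟩ := exists_forall_periodic_sub_le hv.continuous (hper γ hγ) hcw (by
    intro x y hxy
    have := sq_le_sq.2 hxy
    simp only [hw]
    gcongr)
  have hmax : IsLocalMax (fun x => v γ x - w x) a := Eventually.of_forall ha
  have hderiv : deriv (fun x => v γ x - w x) = fun x => deriv (v γ) x - s * x :=
    funext fun x => ((hdv x).hasDerivAt.sub (hw' x)).deriv
  have hfirst : deriv (v γ) a = s * a := by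
    have h := hmax.deriv_eq_zero
    rw [hderiv] at h
    linarith
  have hsecond : deriv (deriv (v γ)) a ≤ s := by
    have h := hmax.deriv_deriv_nonpos_s9 (hv.continuous.sub hcw).continuousAt
    have hsub : HasDerivAt (fun x => deriv (v γ) x - s * x) (deriv (deriv (v γ)) a - s * 1) a :=
      (hddv a).hasDerivAt.sub ((hasDerivAt_id a).const_mul s)
    rw [hderiv, hsub.deriv] at h
    linarith
  have hle : v γ a - w a ≤ 0 := by
    have hode := hODE γ hγ a
    rw [hfirst] at hode
    have hcos : γ * (1 - a ^ 2 / 2) ≤ γ * Real.cos a :=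
      mul_le_mul_of_nonneg_left (Real.one_sub_sq_div_two_le_cos) hγ
    have hσ2 : σ ^ 2 / 2 * deriv (deriv (v γ)) a ≤ σ ^ 2 / 2 * s := by gcongr
    have hβw : β * w a = -γ + β * s * (a ^ 2 / 2) + s * σ ^ 2 / 2 := by
      simp only [hw]
      field_simp
      ring
    have hnn : 0 ≤ β * s * (a ^ 2 / 2) := by positivity
    have hsq : (s * a) ^ 2 = γ * a ^ 2 := by rw [mul_pow, hs2]
    rw [hsq] at hode
    have hprod : β * (v γ a - w a) ≤ 0 := by
      rw [mul_sub]
      linarith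
    exact nonpos_of_mul_nonpos_right hprod hβ
  intro x _
  have := ha x
  change v γ x ≤ w x
  linarith
end
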